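/- arXiv:1201.4439 — 5 statements merged into one kernel-verified Lean document; each statement's English description precedes it below -/
import Mathlib

section
/- Suppose f is a permutation of ℚ and a₁ < ⋯ < a_k, b₁ < ⋯ < b_k are rational numbers such that (i) f is strictly increasing on {a₁,…,a_k} and strictly decreasing on {b₁,…,b_k}, and (ii) the closed intervals [a₁,a_k] and [b₁,b_k] are disjoint and the closed intervals [f(a₁),f(a_k)] and [f(b_k),f(b₁)] are disjoint. Then f is k-trivial, i.e. every permutation of {1,…,k} is realized by the group Γ_f. -/
/-- `Γ` : the set of shifts, i.e. strictly increasing bijections of `ℚ` onto itself. -/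
def Shifts : Set (Equiv.Perm ℚ) := {g : Equiv.Perm ℚ | StrictMono ⇑g}

/-- `Γ_f` : the subgroup of the symmetric group of `ℚ` generated by `Γ ∪ {f}`. -/
def GammaF (f : Equiv.Perm ℚ) : Subgroup (Equiv.Perm ℚ) :=
  Subgroup.closure (Shifts ∪ {f})

/-- A permutation `g` of `ℚ` realizes a permutation `σ` of `{1, …, k}` if for all
`i, j ∈ {1, …, k}` one has `g(i) < g(j) ↔ σ(i) < σ(j)` (integers regarded as rationals;
here `{1, …, k}` is modelled by `Fin k`, with `i : Fin k` standing for the number `i + 1`). -/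
def Realizes {k : ℕ} (g : Equiv.Perm ℚ) (σ : Equiv.Perm (Fin k)) : Prop :=
  ∀ i j : Fin k, g (((i : ℕ) : ℚ) + 1) < g (((j : ℕ) : ℚ) + 1) ↔ σ i < σ j

/-- A permutation `f` of `ℚ` is `k`-trivial if every permutation of `{1, …, k}` is
realized by some member of the group `Γ_f`. -/
def KTrivial (f : Equiv.Perm ℚ) (k : ℕ) : Prop :=
  ∀ σ : Equiv.Perm (Fin k), ∃ g ∈ GammaF f, Realizes g σ

/-- The shift fixing everything up to `c` and stretching `(c, ∞)` by the factor `t > 0`. -/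
def stretchAbove (c t : ℚ) (ht : 0 < t) : Equiv.Perm ℚ where
  toFun x := if x ≤ c then x else c + (x - c) * t
  invFun x := if x ≤ c then x else c + (x - c) / t
  left_inv x := by
    by_cases h : x ≤ c
    · simp [h]
    · have h1 : 0 < (x - c) * t := mul_pos (by linarith) ht
      have h2 : ¬ (c + (x - c) * t ≤ c) := by linarith
      simp only [h, h2, if_false]
      field_simp
      ring
  right_inv x := by
    by_cases h : x ≤ c
    · simp [h]
    · have h1 : 0 < (x - c) / t := div_pos (by linarith) ht
      have h2 : ¬ (c + (x - c) / t ≤ c) := by linarith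
      simp only [h, h2, if_false]
      field_simp
      ring

theorem stretchAbove_apply (c t : ℚ) (ht : 0 < t) (x : ℚ) :
    stretchAbove c t ht x = if x ≤ c then x else c + (x - c) * t := rfl

theorem stretchAbove_mem_shifts (c t : ℚ) (ht : 0 < t) : stretchAbove c t ht ∈ Shifts := by
  intro x y hxy
  rw [stretchAbove_apply, stretchAbove_apply]
  split_ifs with hx hy hy
  · exact hxy
  · have : 0 < (y - c) * t := mul_pos (by linarith) ht
    linarith
  · linarith
  · have : (x - c) * t < (y - c) * t := mul_lt_mul_of_pos_right (by linarith) ht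
    linarith

theorem mul_mem_shifts {s t : Equiv.Perm ℚ} (hs : s ∈ Shifts) (ht : t ∈ Shifts) :
    s * t ∈ Shifts :=
  fun _ _ h => hs (ht h)

/-- Any two increasing finite sequences of the same length are related by a shift. -/
theorem exists_shift_apply_eq : ∀ {k : ℕ} {x y : Fin k → ℚ}, StrictMono x → StrictMono y →
    ∃ s ∈ Shifts, ∀ i, s (x i) = y i
  | 0, _, _, _, _ => ⟨1, fun _ _ h => h, fun i => i.elim0⟩
  | 1, x, y, _, _ => by
    refine ⟨Equiv.addRight (y 0 - x 0), fun _ _ h => by simpa using h, fun i => ?_⟩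
    rw [Subsingleton.elim i 0]
    simp
  | k + 2, x, y, hx, hy => by
    obtain ⟨s, hs, hsxy⟩ := exists_shift_apply_eq (k := k + 1)
      (hx.comp Fin.strictMono_castSucc) (hy.comp Fin.strictMono_castSucc)
    simp only [Function.comp_apply] at hsxy
    set c := y (Fin.last k).castSucc with hc
    have hz : c < s (x (Fin.last (k + 1))) := by
      rw [hc, ← hsxy]
      exact hs (hx (Fin.castSucc_lt_last _))
    have hw : c < y (Fin.last (k + 1)) := hy (Fin.castSucc_lt_last _)
    have ht : 0 < (y (Fin.last (k + 1)) - c) / (s (x (Fin.last (k + 1))) - c) :=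
      div_pos (by linarith) (by linarith)
    refine ⟨stretchAbove c _ ht * s, mul_mem_shifts (stretchAbove_mem_shifts _ _ _) hs,
      fun i => ?_⟩
    rw [Equiv.Perm.mul_apply, stretchAbove_apply]
    induction i using Fin.lastCases with
    | last =>
      rw [if_neg hz.not_ge, mul_div_cancel₀ _ (by linarith)]
      ring
    | cast i =>
      have hi : y i.castSucc ≤ c := hy.monotone (Fin.castSucc_le_castSucc_iff.2 (Fin.le_last i))
      rw [hsxy, if_pos hi]

/-- The permutations of the initial segment `{1, …, k}` induced by members of `G`. -/
def inducedPerms (G : Subgroup (Equiv.Perm ℚ)) (k : ℕ) : Subgroup (Equiv.Perm (Fin k)) where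
  carrier := {σ | ∃ g ∈ G, ∀ i : Fin k, g (((i : ℕ) : ℚ) + 1) = ((σ i : ℕ) : ℚ) + 1}
  mul_mem' := by
    rintro σ τ ⟨g, hg, hgσ⟩ ⟨h, hh, hhτ⟩
    exact ⟨g * h, mul_mem hg hh, fun i => by simp [hhτ, hgσ]⟩
  one_mem' := ⟨1, one_mem _, fun _ => rfl⟩
  inv_mem' := by
    rintro σ ⟨g, hg, hgσ⟩
    refine ⟨g⁻¹, inv_mem hg, fun i => ?_⟩
    rw [Equiv.Perm.inv_eq_iff_eq, hgσ]
    simp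

theorem strictMono_natCast_add_one (k : ℕ) :
    StrictMono fun i : Fin k => ((i : ℕ) : ℚ) + 1 := by
  intro i j h
  have : ((i : ℕ) : ℚ) < ((j : ℕ) : ℚ) := by exact_mod_cast h
  simpa using this

theorem kTrivial_of_inducedPerms_eq_top {f : Equiv.Perm ℚ} {k : ℕ}
    (h : inducedPerms (GammaF f) k = ⊤) : KTrivial f k := by
  intro σ
  obtain ⟨g, hg, hgσ⟩ : σ ∈ inducedPerms (GammaF f) k := h ▸ Subgroup.mem_top σ
  refine ⟨g, hg, fun i j => ?_⟩
  rw [hgσ, hgσ]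
  exact (strictMono_natCast_add_one k).lt_iff_lt

/-- If `f` orders the values at an increasing sequence according to `σ`, then `σ` is induced by
a member of `GammaF f`. -/
theorem mem_inducedPerms {f : Equiv.Perm ℚ} {k : ℕ} {x : Fin k → ℚ} (hx : StrictMono x)
    (σ : Equiv.Perm (Fin k)) (hσ : ∀ i j, σ i < σ j → f (x i) < f (x j)) :
    σ ∈ inducedPerms (GammaF f) k := by
  obtain ⟨s, hs, hsx⟩ := exists_shift_apply_eq (strictMono_natCast_add_one k) hx
  have hy : StrictMono fun i => f (x (σ.symm i)) := fun i j h => hσ _ _ (by simpa using h)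
  obtain ⟨t, ht, hty⟩ := exists_shift_apply_eq hy (strictMono_natCast_add_one k)
  have hΓ : ∀ u ∈ Shifts ∪ {f}, u ∈ GammaF f := fun u hu => Subgroup.subset_closure hu
  refine ⟨t * f * s, mul_mem (mul_mem (hΓ t (.inl ht)) (hΓ f (.inr rfl))) (hΓ s (.inl hs)),
    fun i => ?_⟩
  have := hty (σ i)
  simp only [Equiv.symm_apply_apply] at this
  simp [hsx, this]

/-- The permutation of `Fin k` reversing the order of the elements that are at least `m`. -/
def suffixRev (k m : ℕ) : Equiv.Perm (Fin k) :=
  Function.Involutive.toPerm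
    (fun i => if h : i.val < m then i else ⟨m + (k - 1) - i.val, by omega⟩) (by
      intro i
      ext
      by_cases h : i.val < m
      · simp [h]
      · have h2 : ¬ (m + (k - 1) - i.val < m) := by omega
        simp only [h, h2, dite_false]
        omega)

theorem suffixRev_val (k m : ℕ) (i : Fin k) :
    (suffixRev k m i).val = if i.val < m then i.val else m + (k - 1) - i.val := by
  change (if h : i.val < m then i else (⟨m + (k - 1) - i.val, by omega⟩ : Fin k)).val = _
  split_ifs <;> rfl

/-- The reversals of final segments generate the symmetric group. -/
theorem eq_top_of_suffixRev_mem {k : ℕ} (H : Subgroup (Equiv.Perm (Fin k)))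
    (hH : ∀ m, suffixRev k m ∈ H) : H = ⊤ := by
  cases k with
  | zero => exact Subsingleton.elim _ _
  | succ n =>
    have hswap : ∀ i : Fin n, Equiv.swap i.castSucc i.succ ∈ H := by
      intro i
      have : Equiv.swap i.castSucc i.succ =
          suffixRev (n + 1) i * suffixRev (n + 1) (n - 1) * suffixRev (n + 1) i := by
        ext j
        simp only [Equiv.Perm.mul_apply, Equiv.swap_apply_def, suffixRev_val, Fin.ext_iff,
          Fin.val_castSucc, Fin.val_succ, apply_ite Fin.val]
        split_ifs <;> omega
      rw [this]
      exact mul_mem (mul_mem (hH _) (hH _)) (hH _)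
    have hle : Submonoid.closure (Set.range fun i : Fin n => Equiv.swap i.castSucc i.succ) ≤
        H.toSubmonoid := by
      rw [Submonoid.closure_le]
      rintro _ ⟨i, rfl⟩
      exact hswap i
    rw [Equiv.Perm.mclosure_swap_castSucc_succ] at hle
    exact (Subgroup.eq_top_iff' H).2 fun σ => hle (Submonoid.mem_top σ)

/-- Two disjoint closed intervals lie on different sides of each other. -/
theorem lt_or_lt_of_Icc_inter_Icc_eq_empty {a b c d : ℚ} (hab : a ≤ b) (hcd : c ≤ d)
    (h : Set.Icc a b ∩ Set.Icc c d = ∅) : b < c ∨ d < a := by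
  by_contra! hcon
  have : max a c ∈ Set.Icc a b ∩ Set.Icc c d :=
    ⟨⟨le_max_left _ _, max_le hab hcon.1⟩, ⟨le_max_right _ _, max_le hcon.2 hcd⟩⟩
  rw [h] at this
  exact this

/-- Following the first `m` terms of one increasing sequence by terms of a larger one. -/
theorem strictMono_ite {k : ℕ} {a b : Fin k → ℚ} (ha : StrictMono a) (hb : StrictMono b)
    (hab : ∀ i j, a i < b j) (m : ℕ) :
    StrictMono fun i : Fin k => if i.val < m then a i else b i := by
  intro i j h
  have hv : i.val < j.val := h
  dsimp only
  split_ifs with h1 h2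
  · exact ha h
  · exact hab i j
  · omega
  · exact hb h

/-- Suppose `f` is a permutation of `ℚ` and `a₁ < ⋯ < a_k`, `b₁ < ⋯ < b_k` are rationals
such that `f` is strictly increasing on the `aᵢ` and strictly decreasing on the `bᵢ`, with
`[a₁, a_k] ∩ [b₁, b_k] = ∅` and `[f(a₁), f(a_k)] ∩ [f(b_k), f(b₁)] = ∅`.
Then `f` is `k`-trivial. -/
theorem ktrivial_of_inc_dec (f : Equiv.Perm ℚ) (k : ℕ) (hk : 0 < k)
    (a b : Fin k → ℚ) (ha : StrictMono a) (hb : StrictMono b)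
    (hfa : ∀ i j : Fin k, i < j → f (a i) < f (a j))
    (hfb : ∀ i j : Fin k, i < j → f (b j) < f (b i))
    (hdisj : Set.Icc (a ⟨0, hk⟩) (a ⟨k - 1, by omega⟩) ∩
      Set.Icc (b ⟨0, hk⟩) (b ⟨k - 1, by omega⟩) = ∅)
    (hfdisj : Set.Icc (f (a ⟨0, hk⟩)) (f (a ⟨k - 1, by omega⟩)) ∩
      Set.Icc (f (b ⟨k - 1, by omega⟩)) (f (b ⟨0, hk⟩)) = ∅) :
    KTrivial f k := by
  have hle0 : ∀ i : Fin k, (⟨0, hk⟩ : Fin k) ≤ i := fun i => Nat.zero_le _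
  have hle1 : ∀ i : Fin k, i ≤ (⟨k - 1, by omega⟩ : Fin k) := fun i =>
    Fin.le_def.2 (by simp only; omega)
  have hfa' : StrictMono fun i => f (a i) := fun i j h => hfa i j h
  have hfb' : StrictAnti fun i => f (b i) := fun i j h => hfb i j h
  have hdom : (∀ i j, a i < b j) ∨ ∀ i j, b i < a j := by
    refine (lt_or_lt_of_Icc_inter_Icc_eq_empty (ha.monotone (hle0 _))
      (hb.monotone (hle0 _)) hdisj).imp (fun h i j => ?_) fun h i j => ?_
    · exact ((ha.monotone (hle1 i)).trans_lt h).trans_le (hb.monotone (hle0 j))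
    · exact ((hb.monotone (hle1 i)).trans_lt h).trans_le (ha.monotone (hle0 j))
  have hcod : (∀ i j, f (a i) < f (b j)) ∨ ∀ i j, f (b i) < f (a j) := by
    refine (lt_or_lt_of_Icc_inter_Icc_eq_empty (hfa'.monotone (hle0 _))
      (hfb'.antitone (hle0 _)) hfdisj).imp (fun h i j => ?_) fun h i j => ?_
    · exact ((hfa'.monotone (hle1 i)).trans_lt h).trans_le (hfb'.antitone (hle1 j))
    · exact ((hfb'.antitone (hle0 i)).trans_lt h).trans_le (hfa'.monotone (hle0 j))
  set H := inducedPerms (GammaF f) k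
  have hrev : suffixRev k 0 ∈ H := by
    refine mem_inducedPerms hb _ fun i j h => hfb' ?_
    rw [Fin.lt_def, suffixRev_val, suffixRev_val] at h
    rw [Fin.lt_def]
    simp only [Nat.not_lt_zero, if_false] at h
    omega
  refine kTrivial_of_inducedPerms_eq_top (eq_top_of_suffixRev_mem H fun m => ?_)
  obtain hm | hm := le_total k m
  · convert H.one_mem
    ext i
    rw [suffixRev_val, if_pos (by omega)]
    rfl
  have hcancel_left : ∀ σ, suffixRev k 0 * σ ∈ H → σ ∈ H := fun σ h =>
    (H.mul_mem_cancel_left hrev).1 h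
  have hcancel_right : ∀ σ, σ * suffixRev k 0 ∈ H → σ ∈ H := fun σ h =>
    (H.mul_mem_cancel_right hrev).1 h
  obtain hab | hba := hdom <;> obtain hfab | hfba := hcod
  · refine mem_inducedPerms (strictMono_ite ha hb hab m) _ fun i j h => ?_
    rw [Fin.lt_def, suffixRev_val, suffixRev_val] at h
    split_ifs at h ⊢
    · exact hfa' h
    · exact hfab _ _
    · omega
    · exact hfb' (Fin.lt_def.2 (by omega))
  · refine hcancel_right _ (mem_inducedPerms (strictMono_ite ha hb hab (k - m)) _
      fun i j h => ?_)
    simp only [Fin.lt_def, Equiv.Perm.mul_apply, suffixRev_val, Nat.not_lt_zero, if_false] at h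
    split_ifs at h ⊢ <;>
      first
      | omega
      | exact hfba _ _
      | exact hfa' (Fin.lt_def.2 (by omega))
      | exact hfb' (Fin.lt_def.2 (by omega))
  · refine hcancel_left _ (mem_inducedPerms (strictMono_ite hb ha hba m) _ fun i j h => ?_)
    simp only [Fin.lt_def, Equiv.Perm.mul_apply, suffixRev_val, Nat.not_lt_zero, if_false] at h
    split_ifs at h ⊢ <;>
      first
      | omega
      | exact hfab _ _
      | exact hfa' (Fin.lt_def.2 (by omega))
      | exact hfb' (Fin.lt_def.2 (by omega))
  · refine hcancel_left _ (hcancel_right _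
      (mem_inducedPerms (strictMono_ite hb ha hba (k - m)) _ fun i j h => ?_))
    simp only [Fin.lt_def, Equiv.Perm.mul_apply, suffixRev_val, Nat.not_lt_zero, if_false] at h
    split_ifs at h ⊢ <;>
      first
      | omega
      | exact hfba _ _
      | exact hfa' (Fin.lt_def.2 (by omega))
      | exact hfb' (Fin.lt_def.2 (by omega))
end

section
/- Every nontrivial permutation of ℚ is continuous on ℚ (with respect to the order topology on ℚ). -/
/-- A permutation `f` of `ℚ` is `k`-nontrivial if some permutation of `{1, …, k}` is not
realized by the group `Γ_f`; it is nontrivial if it is `k`-nontrivial for some `k`. -/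
def Nontrivial' (f : Equiv.Perm ℚ) : Prop :=
  ∃ k : ℕ, ∃ σ : Equiv.Perm (Fin k), ∀ g ∈ GammaF f, ¬ Realizes g σ

open Equiv Filter Topology Function

theorem exists_shift_fix_Iic {b u v : ℚ} (hu : b < u) (hv : b < v) :
    ∃ g : Perm ℚ, StrictMono g ∧ (∀ x ≤ b, g x = x) ∧ g u = v := by
  have hu' : 0 < u - b := sub_pos.2 hu
  have hv' : 0 < v - b := sub_pos.2 hv
  set s : ℚ := (v - b) / (u - b) with hs
  have hs0 : 0 < s := div_pos hv' hu'
  let F : ℚ → ℚ := fun x => if x ≤ b then x else b + (x - b) * s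
  have hF : StrictMono F := by
    intro x y hxy
    simp only [F]
    split_ifs with h1 h2 h2
    · exact hxy
    · push Not at h2
      have := mul_pos (sub_pos.2 h2) hs0
      linarith
    · linarith
    · have := mul_lt_mul_of_pos_right (sub_lt_sub_right hxy b) hs0
      linarith
  have hsurj : Surjective F := by
    intro y
    by_cases hy : y ≤ b
    · exact ⟨y, by simp [F, hy]⟩
    · push Not at hy
      have h : 0 < (y - b) / s := div_pos (sub_pos.2 hy) hs0
      refine ⟨b + (y - b) / s, ?_⟩
      simp only [F]
      rw [if_neg (by linarith)]
      field_simp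
      ring
  refine ⟨Equiv.ofBijective F ⟨hF.injective, hsurj⟩, hF, fun x hx => if_pos hx, ?_⟩
  change F u = v
  simp only [F]
  rw [if_neg (not_le.2 hu), hs, mul_div_cancel₀ _ hu'.ne']
  ring

/-- Finite increasing tuples of rationals of the same length are conjugate under shifts. -/
theorem exists_shift_map_tuple {k : ℕ} (a b : Fin k → ℚ) (ha : StrictMono a) (hb : StrictMono b) :
    ∃ g : Perm ℚ, StrictMono g ∧ ∀ i, g (a i) = b i := by
  induction k with
  | zero => exact ⟨1, strictMono_id, fun i => i.elim0⟩
  | succ k ih =>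
    obtain ⟨g, hg, hgab⟩ := ih (a ∘ Fin.castSucc) (b ∘ Fin.castSucc)
      (ha.comp Fin.strictMono_castSucc) (hb.comp Fin.strictMono_castSucc)
    have key : ∃ c : ℚ, c < g (a (Fin.last k)) ∧ c < b (Fin.last k) ∧
        ∀ i : Fin k, b i.castSucc ≤ c := by
      rcases k with _ | k
      · obtain ⟨c, hc⟩ := exists_lt (min (g (a (Fin.last 0))) (b (Fin.last 0)))
        exact ⟨c, (lt_min_iff.1 hc).1, (lt_min_iff.1 hc).2, fun i => i.elim0⟩
      · refine ⟨b (Fin.last k).castSucc, ?_, hb (Fin.castSucc_lt_last _), fun i =>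
          hb.monotone (Fin.castSucc_le_castSucc_iff.2 (Fin.le_last i))⟩
        have := hgab (Fin.last k)
        simp only [comp_apply] at this
        rw [← this]
        exact hg (ha (Fin.castSucc_lt_last _))
    obtain ⟨c, h1, h2, h3⟩ := key
    obtain ⟨h, hh, hfix, hlast⟩ := exists_shift_fix_Iic h1 h2
    refine ⟨h * g, hh.comp hg, fun i => ?_⟩
    induction i using Fin.lastCases with
    | last => simpa using hlast
    | cast i =>
      have := hgab i
      simp only [comp_apply] at this
      rw [Perm.mul_apply, this, hfix _ (h3 i)]

/-- A group of permutations of `ℚ` that contains all shifts and is closed in the topology of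
pointwise convergence. -/
structure IsClosedOverShifts (K : Subgroup (Perm ℚ)) : Prop where
  shift_mem : ∀ g : Perm ℚ, StrictMono g → g ∈ K
  closed : ∀ g : Perm ℚ, (∀ s : Finset ℚ, ∃ h ∈ K, ∀ x ∈ s, h x = g x) → g ∈ K

/-- The closure of a permutation group in the topology of pointwise convergence. -/
def pointwiseClosure (H : Subgroup (Perm ℚ)) : Subgroup (Perm ℚ) where
  carrier := {g | ∀ s : Finset ℚ, ∃ h ∈ H, ∀ x ∈ s, h x = g x}
  one_mem' := fun _ => ⟨1, H.one_mem, fun _ _ => rfl⟩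
  mul_mem' := by
    intro g₁ g₂ h₁ h₂ s
    obtain ⟨k₂, hk₂, e₂⟩ := h₂ s
    obtain ⟨k₁, hk₁, e₁⟩ := h₁ (s.image g₂)
    refine ⟨k₁ * k₂, H.mul_mem hk₁ hk₂, fun x hx => ?_⟩
    rw [Perm.mul_apply, e₂ x hx, e₁ _ (Finset.mem_image_of_mem _ hx), Perm.mul_apply]
  inv_mem' := by
    intro g hg s
    obtain ⟨k, hk, e⟩ := hg (s.image (g⁻¹ : Perm ℚ))
    refine ⟨k⁻¹, H.inv_mem hk, fun x hx => ?_⟩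
    have := e _ (Finset.mem_image_of_mem _ hx)
    rw [Perm.inv_eq_iff_eq, this]
    simp

theorem le_pointwiseClosure (H : Subgroup (Perm ℚ)) : H ≤ pointwiseClosure H :=
  fun g hg _ => ⟨g, hg, fun _ _ => rfl⟩

theorem isClosedOverShifts_pointwiseClosure {H : Subgroup (Perm ℚ)}
    (hH : ∀ g : Perm ℚ, StrictMono g → g ∈ H) : IsClosedOverShifts (pointwiseClosure H) where
  shift_mem g hg := le_pointwiseClosure H (hH g hg)
  closed g hg s := by
    obtain ⟨h, hh, e⟩ := hg s
    obtain ⟨k, hk, e'⟩ := hh s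
    exact ⟨k, hk, fun x hx => (e' x hx).trans (e x hx)⟩

/-- The permutations of `{0, …, k - 1}` that are restrictions of members of `K`. -/
def patternGroup (K : Subgroup (Perm ℚ)) (k : ℕ) : Subgroup (Perm (Fin k)) where
  carrier := {σ | ∃ h ∈ K, ∀ i : Fin k, h ((i : ℕ) : ℚ) = ((σ i : ℕ) : ℚ)}
  one_mem' := ⟨1, K.one_mem, fun _ => rfl⟩
  mul_mem' := by
    rintro σ τ ⟨g, hg, eg⟩ ⟨h, hh, eh⟩
    exact ⟨g * h, K.mul_mem hg hh, fun i => by simp [eg, eh]⟩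
  inv_mem' := by
    rintro σ ⟨g, hg, eg⟩
    refine ⟨g⁻¹, K.inv_mem hg, fun i => ?_⟩
    rw [Perm.inv_eq_iff_eq, eg]
    simp

theorem strictMono_fin_cast (k : ℕ) : StrictMono (fun i : Fin k => ((i : ℕ) : ℚ)) :=
  fun _ _ h => Nat.cast_lt.2 h

namespace IsClosedOverShifts

variable {K : Subgroup (Perm ℚ)}

theorem mem_patternGroup (hK : IsClosedOverShifts K) {k : ℕ} {g : Perm ℚ} (hg : g ∈ K)
    {a b : Fin k → ℚ} (ha : StrictMono a) (hb : StrictMono b) {σ τ : Perm (Fin k)}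
    (h : ∀ i, g (a (τ i)) = b (σ i)) : σ * τ⁻¹ ∈ patternGroup K k := by
  obtain ⟨s, hs, es⟩ := exists_shift_map_tuple _ a (strictMono_fin_cast k) ha
  obtain ⟨t, ht, et⟩ := exists_shift_map_tuple b _ hb (strictMono_fin_cast k)
  refine ⟨t * g * s, K.mul_mem (K.mul_mem (hK.shift_mem t ht) hg) (hK.shift_mem s hs),
    fun i => ?_⟩
  have : g (a i) = b (σ (τ⁻¹ i)) := by simpa using h (τ⁻¹ i)
  rw [Perm.mul_apply, Perm.mul_apply, es, this, et, Perm.mul_apply]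

theorem mem_patternGroup' (hK : IsClosedOverShifts K) {k : ℕ} {g : Perm ℚ} (hg : g ∈ K)
    {a b : Fin k → ℚ} (ha : StrictMono a) (hb : StrictMono b) {σ : Perm (Fin k)}
    (h : ∀ i, g (a i) = b (σ i)) : σ ∈ patternGroup K k := by
  simpa using hK.mem_patternGroup hg ha hb (τ := 1) h

theorem exists_eq_comp (hK : IsClosedOverShifts K) {k : ℕ} {a b : Fin k → ℚ} (ha : StrictMono a)
    (hb : StrictMono b) {σ : Perm (Fin k)} (hσ : σ ∈ patternGroup K k) :
    ∃ g ∈ K, ∀ i, g (a i) = b (σ i) := by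
  obtain ⟨h, hh, e⟩ := hσ
  obtain ⟨s, hs, es⟩ := exists_shift_map_tuple a _ ha (strictMono_fin_cast k)
  obtain ⟨t, ht, et⟩ := exists_shift_map_tuple _ b (strictMono_fin_cast k) hb
  exact ⟨t * h * s, K.mul_mem (K.mul_mem (hK.shift_mem t ht) hh) (hK.shift_mem s hs),
    fun i => by rw [Perm.mul_apply, Perm.mul_apply, es, e, et]⟩

/-- A permutation belongs to `K` if all its finite patterns do. -/
theorem mem_of_forall_pattern (hK : IsClosedOverShifts K) (g : Perm ℚ)
    (h : ∀ (k : ℕ) (a b : Fin k → ℚ) (σ : Perm (Fin k)), StrictMono a → StrictMono b →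
      (∀ i, g (a i) = b (σ i)) → σ ∈ patternGroup K k) : g ∈ K := by
  refine hK.closed g fun s => ?_
  set a : Fin s.card → ℚ := ⇑(s.orderEmbOfFin rfl) with ha
  have ham : StrictMono a := (s.orderEmbOfFin rfl).strictMono
  set τ := Tuple.sort (g ∘ a) with hτ
  have hbm : StrictMono ((g ∘ a) ∘ τ) :=
    (Tuple.monotone_sort (g ∘ a)).strictMono_of_injective
      ((g.injective.comp ham.injective).comp τ.injective)
  have hab : ∀ i, g (a i) = ((g ∘ a) ∘ τ) (τ⁻¹ i) := fun i => by simp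
  obtain ⟨t, ht, et⟩ := hK.exists_eq_comp ham hbm (h _ a _ τ⁻¹ ham hbm hab)
  refine ⟨t, ht, fun x hx => ?_⟩
  have : x ∈ Set.range a := by rw [ha, Finset.range_orderEmbOfFin]; exact hx
  obtain ⟨i, rfl⟩ := this
  rw [et, hab]

theorem eq_top_of_rotate_of_swap (hK : IsClosedOverShifts K)
    (hrot : ∀ n, finRotate (n + 2) ∈ patternGroup K (n + 2))
    (hswap : ∀ n, ∃ i, swap i (finRotate (n + 2) i) ∈ patternGroup K (n + 2)) : K = ⊤ := by
  refine eq_top_iff.2 fun g _ => hK.mem_of_forall_pattern g fun k _ _ σ _ _ _ => ?_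
  match k, σ with
  | 0, σ => rw [Subsingleton.elim σ 1]; exact one_mem _
  | 1, σ => rw [Subsingleton.elim σ 1]; exact one_mem _
  | n + 2, σ =>
    obtain ⟨i, hi⟩ := hswap n
    have : (⊤ : Subgroup (Perm (Fin (n + 2)))) ≤ patternGroup K (n + 2) := by
      rw [← Perm.closure_cycle_adjacent_swap isCycle_finRotate support_finRotate i,
        Subgroup.closure_le]
      rintro _ (rfl | rfl)
      · exact hrot n
      · exact hi
    exact this trivial

theorem neg_mem (hK : IsClosedOverShifts K) (h : ∀ n, Fin.revPerm ∈ patternGroup K n) :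
    Equiv.neg ℚ ∈ K := by
  refine hK.mem_of_forall_pattern _ fun k a b σ ha hb e => ?_
  convert h k
  have : StrictMono (σ * Fin.revPerm : Perm (Fin k)) := by
    intro i j hij
    rw [← hb.lt_iff_lt]
    simp only [Perm.mul_apply, ← e, Equiv.neg_apply, neg_lt_neg_iff]
    exact ha (Fin.rev_lt_rev.2 hij)
  have h1 : σ * Fin.revPerm = 1 := by
    ext i
    have := Subsingleton.elim (this.orderIsoOfSurjective _ (Equiv.surjective _))
      (OrderIso.refl (Fin k))
    have := congrArg (fun e => ((e i : Fin k) : ℕ)) this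
    simpa using this
  rw [mul_eq_one_iff_eq_inv] at h1
  rw [h1]
  ext i
  simp [Fin.revPerm]

end IsClosedOverShifts

theorem exists_subseq_strictMono_or_strictAnti {u : ℕ → ℚ} (hu : Injective u) :
    ∃ φ : ℕ ↪o ℕ, StrictMono (u ∘ φ) ∨ StrictAnti (u ∘ φ) := by
  obtain ⟨φ, h | h⟩ := exists_increasing_or_nonincreasing_subseq (· < ·) u
  · exact ⟨φ, .inl fun m n hmn => h m n hmn⟩
  · exact ⟨φ, .inr fun m n hmn => lt_of_le_of_ne (not_lt.1 (h m n hmn)) fun e =>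
      hmn.ne' (φ.injective (hu e))⟩

namespace IsClosedOverShifts

variable {K : Subgroup (Perm ℚ)} {f : Perm ℚ} {x : ℕ → ℚ} {p : ℚ}

theorem val_finRotate {n : ℕ} (i : Fin (n + 1)) :
    (finRotate (n + 1) i : ℕ) = if (i : ℕ) = n then 0 else (i : ℕ) + 1 := by
  rw [coe_finRotate]
  simp [Fin.ext_iff]

theorem val_swap {n : ℕ} (i j k : Fin n) :
    (swap i j k : ℕ) = if (k : ℕ) = i then (j : ℕ) else if (k : ℕ) = j then (i : ℕ) else k := by
  rw [swap_apply_def]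
  simp only [Fin.ext_iff]
  split_ifs <;> rfl

theorem strictMono_finSnoc {n : ℕ} {y : Fin n → ℚ} {q : ℚ} (hy : StrictMono y)
    (h : ∀ i, y i < q) : StrictMono (Fin.snoc y q : Fin (n + 1) → ℚ) := by
  intro i j hij
  induction i using Fin.lastCases with
  | last => exact absurd hij (Fin.le_last j).not_gt
  | cast i =>
    induction j using Fin.lastCases with
    | last => simpa using h i
    | cast j => simpa using hy (Fin.castSucc_lt_castSucc_iff.1 hij)

theorem apply_finCons (f : Perm ℚ) {n : ℕ} (y : Fin n → ℚ) (q : ℚ) (i : Fin (n + 1)) :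
    f ((Fin.cons q y : Fin (n + 1) → ℚ) i) = (Fin.cons (f q) (f ∘ y) : Fin (n + 1) → ℚ) i := by
  induction i using Fin.cases <;> simp

/-- Moving the largest point below an increasing tuple produces a rotation. -/
theorem finRotate_mem_of_last (hK : IsClosedOverShifts K) (hf : f ∈ K) {n : ℕ} {y : Fin n → ℚ}
    (hy : StrictMono y) (hyp : ∀ i, y i < p) (hfy : StrictMono (f ∘ y))
    (hfp : ∀ i, f p < f (y i)) : finRotate (n + 1) ∈ patternGroup K (n + 1) :=
  hK.mem_patternGroup' hf (b := Fin.cons (f p) (f ∘ y)) (strictMono_finSnoc hy hyp)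
    (Fin.strictMono_cons.2 ⟨hfp, hfy⟩) fun i => by
    rw [Fin.snoc_eq_cons_rotate, apply_finCons]

/-- Moving the smallest point above an increasing tuple produces a rotation. -/
theorem finRotate_mem_of_zero (hK : IsClosedOverShifts K) (hf : f ∈ K) {n : ℕ} {y : Fin n → ℚ}
    (hy : StrictMono y) (hyp : ∀ i, p < y i) (hfy : StrictMono (f ∘ y))
    (hfp : ∀ i, f (y i) < f p) : finRotate (n + 1) ∈ patternGroup K (n + 1) := by
  rw [← Subgroup.inv_mem_iff, ← one_mul (finRotate (n + 1))⁻¹]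
  refine hK.mem_patternGroup hf (Fin.strictMono_cons.2 ⟨hyp, hy⟩)
    (strictMono_finSnoc hfy hfp) fun i => ?_
  rw [Fin.snoc_eq_cons_rotate, apply_finCons, Perm.one_apply]

/-- Reversing an increasing tuple above a fixed smallest point produces a rotation followed by
a reversal. -/
theorem finRotate_mul_revPerm_mem (hK : IsClosedOverShifts K) (hf : f ∈ K) {n : ℕ}
    {y : Fin n → ℚ} (hy : StrictMono y) (hyp : ∀ i, p < y i) (hfy : StrictAnti (f ∘ y))
    (hfp : ∀ i, f p < f (y i)) :
    finRotate (n + 1) * Fin.revPerm ∈ patternGroup K (n + 1) := by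
  have h : StrictMono (f ∘ y ∘ Fin.rev) := fun _ _ hij => hfy (Fin.rev_lt_rev.2 hij)
  refine hK.mem_patternGroup' hf (b := Fin.cons (f p) (f ∘ y ∘ Fin.rev))
    (Fin.strictMono_cons.2 ⟨hyp, hy⟩) (Fin.strictMono_cons.2 ⟨fun i => hfp i.rev, h⟩) fun i => ?_
  rw [apply_finCons, Perm.mul_apply]
  have := congrFun (Fin.snoc_eq_cons_rotate (f ∘ y ∘ Fin.rev) (f p)) (Fin.revPerm i)
  rw [← this]
  simp [Fin.snoc_rev, comp_def]

theorem swap_mul_finRotate_mem (hK : IsClosedOverShifts K) (hf : f ∈ K) (hx : StrictMono x)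
    (hxp : ∀ n, x n < p) (hfx : StrictMono (f ∘ x)) (hfp : ∀ n, f p < f (x n)) {w : ℚ}
    (hw : ∀ n, w < x n) (hfw : f w < f p) (n : ℕ) :
    swap 0 (finRotate (n + 2) 0) * finRotate (n + 2) ∈ patternGroup K (n + 2) := by
  refine hK.mem_patternGroup' hf
    (a := fun i => if (i : ℕ) = 0 then w else if (i : ℕ) = n + 1 then p else x i)
    (b := fun i => if (i : ℕ) = 0 then f w else if (i : ℕ) = 1 then f p else f (x (i - 1)))
    ?_ ?_ ?_
  · intro i j (hij : (i : ℕ) < j)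
    have := @hx i j
    grind
  · intro i j (hij : (i : ℕ) < j)
    have := @hfx (i - 1) (j - 1)
    have := hfp (j - 1)
    grind
  · intro i
    simp only [Perm.mul_apply, val_swap, val_finRotate]
    grind

theorem swap_mul_finRotate_sq_mem (hK : IsClosedOverShifts K) (hf : f ∈ K) (hx : StrictMono x)
    (hxp : ∀ n, x n < p) (hfx : StrictMono (f ∘ x)) (hfp : ∀ n, f p < f (x n)) {w : ℚ}
    (hw : p < w) (hfw : f w < f p) (n : ℕ) :
    swap 0 (finRotate (n + 2) 0) * finRotate (n + 2) * finRotate (n + 2) ∈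
      patternGroup K (n + 2) := by
  refine hK.mem_patternGroup' hf
    (a := fun i => if (i : ℕ) = n then p else if (i : ℕ) = n + 1 then w else x i)
    (b := fun i => if (i : ℕ) = 0 then f w else if (i : ℕ) = 1 then f p else f (x (i - 2)))
    ?_ ?_ ?_
  · intro i j (hij : (i : ℕ) < j)
    have := @hx i j
    have := hxp i
    grind
  · intro i j (hij : (i : ℕ) < j)
    have := @hfx (i - 2) (j - 2)
    have := hfp (j - 2)
    grind
  · intro i
    simp only [Perm.mul_apply, val_swap, val_finRotate]
    grind

theorem eq_top_of_lt_left (hK : IsClosedOverShifts K) (hf : f ∈ K) (hx : StrictMono x)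
    (hxp : ∀ n, x n < p) (hcof : ∀ y < p, ∃ N, y < x N) (hfx : StrictMono (f ∘ x))
    (hfp : ∀ n, f p < f (x n)) : K = ⊤ := by
  have hrot : ∀ n, finRotate (n + 1) ∈ patternGroup K (n + 1) := fun n =>
    hK.finRotate_mem_of_last hf (y := fun i => x i) (fun _ _ hij => hx hij) (fun _ => hxp _)
      (fun _ _ hij => hfx hij) fun _ => hfp _
  refine hK.eq_top_of_rotate_of_swap (fun n => hrot (n + 1)) fun n => ⟨0, ?_⟩
  obtain ⟨v, hv⟩ := exists_lt (f p)
  obtain ⟨w, rfl⟩ := f.surjective v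
  have hwp : w ≠ p := by rintro rfl; exact lt_irrefl _ hv
  rcases hwp.lt_or_gt with hwp | hwp
  · obtain ⟨N, hN⟩ := hcof w hwp
    have hs : StrictMono fun i : ℕ => N + i := fun _ _ h => Nat.add_lt_add_left h N
    rw [← Subgroup.mul_mem_cancel_right _ (hrot (n + 1))]
    exact hK.swap_mul_finRotate_mem hf (x := fun i => x (N + i)) (hx.comp hs)
      (fun _ => hxp _) (hfx.comp hs) (fun _ => hfp _)
      (fun i => hN.trans_le (hx.monotone (Nat.le_add_right N i))) hv n
  · rw [← Subgroup.mul_mem_cancel_right _ (hrot (n + 1)),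
      ← Subgroup.mul_mem_cancel_right _ (hrot (n + 1))]
    exact hK.swap_mul_finRotate_sq_mem hf hx hxp hfx hfp hwp hv n

/-- If `f` exchanges two points `p < q` above an increasing sequence and is otherwise increasing,
then all transpositions of the last two points are patterns of `K`. -/
theorem swap_last_mem_patternGroup (hK : IsClosedOverShifts K) (hf : f ∈ K) {q : ℚ}
    (hx : StrictMono x) (hxp : ∀ n, x n < p) (hpq : p < q) (hfx : StrictMono (f ∘ x))
    (hfq : ∀ n, f (x n) < f q) (hqp : f q < f p) (n : ℕ) :
    swap (Fin.last n).castSucc (finRotate (n + 2) (Fin.last n).castSucc) ∈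
      patternGroup K (n + 2) := by
  refine hK.mem_patternGroup' hf
    (a := fun i => if (i : ℕ) = n then p else if (i : ℕ) = n + 1 then q else x i)
    (b := fun i => if (i : ℕ) = n then f q else if (i : ℕ) = n + 1 then f p else f (x i)) ?_ ?_ ?_
  · intro i j (hij : (i : ℕ) < j)
    have := @hx i j
    have := hxp i
    grind
  · intro i j (hij : (i : ℕ) < j)
    have := @hfx i j
    have := hfq i
    grind
  · intro i
    simp only [val_swap, val_finRotate, Fin.val_castSucc, Fin.val_last]
    grind

/-- An infinite set contains arbitrarily long increasing tuples on which `f` is strictly monotone,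
always of the same kind. -/
theorem forall_strictMono_or_forall_strictAnti (S : Set ℚ) (hS : S.Infinite) (f : Perm ℚ) :
    (∀ n, ∃ z : Fin n → ℚ, StrictMono z ∧ (∀ i, z i ∈ S) ∧ StrictMono (f ∘ z)) ∨
    (∀ n, ∃ z : Fin n → ℚ, StrictMono z ∧ (∀ i, z i ∈ S) ∧ StrictAnti (f ∘ z)) := by
  let u : ℕ → ℚ := fun n => hS.natEmbedding S n
  have huS : ∀ n, u n ∈ S := fun n => (hS.natEmbedding S n).2
  have hu : Injective u := Subtype.val_injective.comp (hS.natEmbedding S).injective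
  obtain ⟨φ, hφ⟩ := exists_subseq_strictMono_or_strictAnti hu
  obtain ⟨ψ, hψ⟩ := 
    exists_subseq_strictMono_or_strictAnti (f.injective.comp (hu.comp φ.injective))
  have hv : ∀ n : ℕ, StrictMono (fun i : Fin n => ψ i) := fun n i j hij => ψ.strictMono hij
  have hr : ∀ n : ℕ, StrictAnti (fun i : Fin n => ψ i.rev) :=
    fun n i j hij => ψ.strictMono (Fin.rev_lt_rev.2 hij)
  rcases hφ with hφ | hφ <;> rcases hψ with hψ | hψ
  · exact .inl fun n => ⟨fun i => u (φ (ψ i)), hφ.comp (hv n), fun _ => huS _,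
      fun i j hij => hψ hij⟩
  · exact .inr fun n => ⟨fun i => u (φ (ψ i)), hφ.comp (hv n), fun _ => huS _,
      fun i j hij => hψ hij⟩
  · exact .inr fun n => ⟨fun i => u (φ (ψ i.rev)), hφ.comp (hr n), fun _ => huS _,
      fun i j hij => hψ (Fin.rev_lt_rev.2 hij)⟩
  · exact .inl fun n => ⟨fun i => u (φ (ψ i.rev)), hφ.comp (hr n), fun _ => huS _,
      fun i j hij => hψ (Fin.rev_lt_rev.2 hij)⟩

theorem revPerm_mem_patternGroup (hK : IsClosedOverShifts K) (hf : f ∈ K) {n : ℕ} {z : Fin n → ℚ}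
    (hz : StrictMono z) (hfz : StrictAnti (f ∘ z)) : Fin.revPerm ∈ patternGroup K n :=
  hK.mem_patternGroup' hf hz (b := fun i => f (z i.rev))
    (fun _ _ hij => hfz (Fin.rev_lt_rev.2 hij)) fun i => by simp

theorem swap_mul_finRotate_inv_mem (hK : IsClosedOverShifts K) (hf : f ∈ K) (hx : StrictMono x)
    (hxp : ∀ n, x n < p) (hfx : StrictMono (f ∘ x)) {z : ℚ} (hz : ∀ n, z < x n)
    (hxz : ∀ n, f (x n) < f z) (hzp : f z < f p) (n : ℕ) :
    swap (Fin.last n).castSucc (finRotate (n + 2) (Fin.last n).castSucc) * (finRotate (n + 2))⁻¹ ∈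
      patternGroup K (n + 2) := by
  refine hK.mem_patternGroup hf
    (a := fun i => if (i : ℕ) = 0 then z else if (i : ℕ) = n + 1 then p else x (i - 1))
    (b := fun i => if (i : ℕ) = n then f z else if (i : ℕ) = n + 1 then f p else f (x i))
    ?_ ?_ ?_
  · intro i j (hij : (i : ℕ) < j)
    have := @hx (i - 1) (j - 1)
    have := hxp (i - 1)
    grind
  · intro i j (hij : (i : ℕ) < j)
    have := @hfx i j
    have := hxz i
    grind
  · intro i
    simp only [val_swap, val_finRotate, Fin.val_castSucc, Fin.val_last]
    grind

theorem eq_top_of_gap_left (hK : IsClosedOverShifts K) (hf : f ∈ K) (hx : StrictMono x)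
    (hxp : ∀ n, x n < p) (hcof : ∀ y < p, ∃ N, y < x N) (hfx : StrictMono (f ∘ x))
    {c : ℚ} (hfc : ∀ n, f (x n) ≤ c) (hc : c < f p) : K = ⊤ := by
  have hS : (f ⁻¹' Set.Ioo c (f p)).Infinite :=
    (Set.Ioo_infinite hc).preimage fun y _ => f.surjective y
  by_cases hz : ∃ z < p, c < f z ∧ f z < f p
  · obtain ⟨z, hzp, hcz, hzf⟩ := hz
    obtain ⟨N, hN⟩ := hcof z hzp
    have hs : StrictMono fun i : ℕ => N + i := fun _ _ h => Nat.add_lt_add_left h N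
    have hzx : ∀ i, z < x (N + i) := fun i => hN.trans_le (hx.monotone (Nat.le_add_right N i))
    have hxz : ∀ i, f (x (N + i)) < f z := fun i => (hfc _).trans_lt hcz
    have hrot : ∀ n, finRotate (n + 1) ∈ patternGroup K (n + 1) := fun n =>
      hK.finRotate_mem_of_zero hf (y := fun i => x (N + i)) (fun _ _ hij => hx (hs hij))
        (fun _ => hzx _) (fun _ _ hij => hfx (hs hij)) fun _ => hxz _
    refine hK.eq_top_of_rotate_of_swap (fun n => hrot (n + 1)) fun n =>
      ⟨(Fin.last n).castSucc, ?_⟩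
    rw [← Subgroup.mul_mem_cancel_right _ (inv_mem (hrot (n + 1)))]
    exact hK.swap_mul_finRotate_inv_mem hf (x := fun i => x (N + i)) (hx.comp hs)
      (fun _ => hxp _) (hfx.comp hs) hzx hxz hzf n
  have hpz : ∀ z ∈ f ⁻¹' Set.Ioo c (f p), p < z := by
    intro z hzS
    by_contra! h
    rcases h.lt_or_eq with h | rfl
    · exact hz ⟨z, h, hzS⟩
    · exact lt_irrefl _ hzS.2
  rcases forall_strictMono_or_forall_strictAnti _ hS f with h | h
  · refine hK.eq_top_of_rotate_of_swap (fun n => ?_) fun n => ⟨(Fin.last n).castSucc, ?_⟩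
    · obtain ⟨z, hz, hzS, hfz⟩ := h (n + 1)
      exact hK.finRotate_mem_of_zero hf hz (fun i => hpz _ (hzS i)) hfz fun i => (hzS i).2
    · obtain ⟨z, -, hzS, -⟩ := h 1
      exact hK.swap_last_mem_patternGroup hf hx hxp (hpz _ (hzS 0)) hfx
        (fun n => (hfc n).trans_lt (hzS 0).1) (hzS 0).2 n
  · refine hK.eq_top_of_rotate_of_swap (fun n => ?_) fun n => ⟨(Fin.last n).castSucc, ?_⟩
    · obtain ⟨y, hy, -, hfy⟩ := h (n + 2)
      obtain ⟨z, hz, hzS, hfz⟩ := h (n + 1)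
      rw [← Subgroup.mul_mem_cancel_right _ (hK.revPerm_mem_patternGroup hf hy hfy)]
      exact hK.finRotate_mul_revPerm_mem hf hz (fun i => (hxp 0).trans (hpz _ (hzS i))) hfz
        fun i => (hfc 0).trans_lt (hzS i).1
    · obtain ⟨z, hz, hzS, hfz⟩ := h 2
      have h01 : (0 : Fin 2) < 1 := by decide
      exact hK.swap_last_mem_patternGroup hf hx (fun n => (hxp n).trans (hpz _ (hzS 0))) (hz h01)
        hfx (fun n => (hfc n).trans_lt (hzS 1).1) (hfz h01) n

end IsClosedOverShifts

/-- A property that holds frequently to the left of `p` holds along a strictly increasing sequence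
converging to `p` on which `f` is strictly monotone. -/
theorem exists_seq_of_frequently_left {p : ℚ} {P : ℚ → Prop} (h : ∃ᶠ y in 𝓝[<] p, P y)
    (f : Perm ℚ) : ∃ x : ℕ → ℚ, StrictMono x ∧ (∀ n, x n < p) ∧ (∀ y < p, ∃ N, y < x N) ∧
      (∀ n, P (x n)) ∧ (StrictMono (f ∘ x) ∨ StrictAnti (f ∘ x)) := by
  obtain ⟨u, hu, hup⟩ := exists_seq_forall_of_frequently
    (h.and_eventually (eventually_mem_nhdsWithin : ∀ᶠ y in 𝓝[<] p, y ∈ Set.Iio p))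
  have hu' : Tendsto u atTop (𝓝 p) := hu.mono_right nhdsWithin_le_nhds
  obtain ⟨φ, hφ | hφ⟩ := exists_increasing_or_nonincreasing_subseq (· < ·) u
  · have hm : StrictMono (u ∘ φ) := fun m n hmn => hφ m n hmn
    obtain ⟨ψ, hψ⟩ := exists_subseq_strictMono_or_strictAnti (f.injective.comp hm.injective)
    refine ⟨u ∘ φ ∘ ψ, hm.comp ψ.strictMono, fun n => (hup _).2, fun y hy => ?_,
      fun n => (hup _).1, hψ⟩
    have ht := hu'.comp (φ.strictMono.tendsto_atTop.comp ψ.strictMono.tendsto_atTop)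
    exact (ht.eventually (lt_mem_nhds hy)).exists
  · have ht := (hu'.comp φ.strictMono.tendsto_atTop).eventually (lt_mem_nhds (hup (φ 0)).2)
    obtain ⟨n, hn, hn0⟩ := (ht.and (eventually_gt_atTop 0)).exists
    exact absurd hn (hφ 0 n hn0)

namespace IsClosedOverShifts

variable {K : Subgroup (Perm ℚ)} {f : Perm ℚ} {p c : ℚ}

theorem neg_mem_of_strictAnti (hK : IsClosedOverShifts K) (hf : f ∈ K) {x : ℕ → ℚ}
    (hx : StrictMono x) (hfx : StrictAnti (f ∘ x)) : Equiv.neg ℚ ∈ K :=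
  hK.neg_mem fun n => hK.revPerm_mem_patternGroup hf (z := fun i : Fin n => x i)
    (fun _ _ hij => hx hij) fun _ _ hij => hfx hij

theorem eq_top_of_frequently_left_le (hK : IsClosedOverShifts K) (hf : f ∈ K)
    (h : ∃ᶠ y in 𝓝[<] p, f y ≤ c) (hc : c < f p) : K = ⊤ := by
  obtain ⟨x, hx, hxp, hcof, hxc, hfx | hfx⟩ := exists_seq_of_frequently_left h f
  · exact hK.eq_top_of_gap_left hf hx hxp hcof hfx hxc hc
  · exact hK.eq_top_of_lt_left (mul_mem (hK.neg_mem_of_strictAnti hf hx hfx) hf) hx hxp hcof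
      (fun _ _ hij => neg_lt_neg (hfx hij)) fun n => neg_lt_neg ((hxc n).trans_lt hc)

theorem eq_top_of_frequently_left_ge (hK : IsClosedOverShifts K) (hf : f ∈ K)
    (h : ∃ᶠ y in 𝓝[<] p, c ≤ f y) (hc : f p < c) : K = ⊤ := by
  obtain ⟨x, hx, hxp, hcof, hxc, hfx | hfx⟩ := exists_seq_of_frequently_left h f
  · exact hK.eq_top_of_lt_left hf hx hxp hcof hfx fun n => hc.trans_le (hxc n)
  · exact hK.eq_top_of_gap_left (mul_mem (hK.neg_mem_of_strictAnti hf hx hfx) hf) hx hxp hcof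
      (fun _ _ hij => neg_lt_neg (hfx hij)) (fun n => neg_le_neg (hxc n)) (neg_lt_neg hc)

/-- Conjugation by negation preserves closed groups containing all shifts. -/
theorem comap_conj_neg (hK : IsClosedOverShifts K) :
    IsClosedOverShifts (K.comap (MulAut.conj (Equiv.neg ℚ)).toMonoidHom) where
  shift_mem g hg := hK.shift_mem _ fun _ _ hij => neg_lt_neg (hg (neg_lt_neg hij))
  closed g hg := by
    refine hK.closed _ fun s => ?_
    obtain ⟨h, hh, e⟩ := hg (s.image (Equiv.neg ℚ))
    exact ⟨_, hh, fun x hx => congrArg Neg.neg (e _ (Finset.mem_image_of_mem _ hx))⟩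

theorem eq_top_of_not_continuousAt (hK : IsClosedOverShifts K) (hf : f ∈ K)
    (h : ¬ ContinuousAt f p) : K = ⊤ := by
  let ν : Perm (Perm ℚ) := (MulAut.conj (Equiv.neg ℚ)).toEquiv
  have hνf : ν f ∈ K.comap (MulAut.conj (Equiv.neg ℚ)).toMonoidHom := by
    have : MulAut.conj (Equiv.neg ℚ) (MulAut.conj (Equiv.neg ℚ) f) = f := by
      ext y
      change - - f (- - y) = f y
      simp
    rw [Subgroup.mem_comap]
    exact this.symm ▸ hf
  have htop : K.comap (MulAut.conj (Equiv.neg ℚ)).toMonoidHom = ⊤ → K = ⊤ := fun h => by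
    refine Subgroup.comap_injective (f := (MulAut.conj (Equiv.neg ℚ)).toMonoidHom)
      (MulAut.conj (Equiv.neg ℚ)).surjective ?_
    rw [Subgroup.comap_top]
    exact h
  have hflip : ∀ P : ℚ → Prop, (∃ᶠ y in 𝓝 p, P y) → ¬ P p →
      (∃ᶠ y in 𝓝[<] p, P y) ∨ ∃ᶠ y in 𝓝[<] (-p), P (-y) := by
    intro P hP hp
    have h1 : ∃ᶠ y in 𝓝[≠] p, P y := by
      rw [← pure_sup_nhdsNE, frequently_sup] at hP
      exact hP.resolve_left (by simpa using hp)
    rw [← nhdsLT_sup_nhdsGT, frequently_sup] at h1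
    refine h1.imp_right fun h2 => ?_
    have : Tendsto (fun y : ℚ => -y) (𝓝[>] p) (𝓝[<] (-p)) := tendsto_neg_nhdsGT
    exact this.frequently (h2.mono fun y hy => by simpa using hy)
  have hneg : ∀ y, ν f y = - f (-y) := fun _ => rfl
  rw [ContinuousAt, tendsto_order, not_and_or] at h
  push Not at h
  rcases h with ⟨c, hc, h⟩ | ⟨c, hc, h⟩
  · rcases hflip (fun y => f y ≤ c) (by simpa using h) (not_le.2 hc) with h | h
    · exact hK.eq_top_of_frequently_left_le hf h hc
    · refine htop (hK.comap_conj_neg.eq_top_of_frequently_left_ge hνf (p := -p) (c := -c) ?_ ?_)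
      · simpa [hneg] using h
      · simpa [hneg] using hc
  · rcases hflip (fun y => c ≤ f y) (by simpa using h) (not_le.2 hc) with h | h
    · exact hK.eq_top_of_frequently_left_ge hf h hc
    · refine htop (hK.comap_conj_neg.eq_top_of_frequently_left_le hνf (p := -p) (c := -c) ?_ ?_)
      · simpa [hneg] using h
      · simpa [hneg] using hc

end IsClosedOverShifts

theorem exists_realizes {k : ℕ} (σ : Perm (Fin k)) :
    ∃ g : Perm ℚ, ∀ i : Fin k, g (((i : ℕ) : ℚ) + 1) = ((σ i : ℕ) : ℚ) + 1 := by
  let e : Fin k ↪ ℚ := ⟨fun i => ((i : ℕ) : ℚ) + 1, fun i j h => by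
    simpa [Fin.ext_iff] using h⟩
  exact ⟨σ.viaFintypeEmbedding e, fun i => Perm.viaFintypeEmbedding_apply_image σ e i⟩

/-- Every nontrivial permutation of `ℚ` is continuous. -/
theorem nontrivial_continuous (f : Equiv.Perm ℚ) (hf : Nontrivial' f) :
    Continuous ⇑f := by
  obtain ⟨k, σ, hσ⟩ := hf
  by_contra hcont
  rw [continuous_iff_continuousAt, not_forall] at hcont
  obtain ⟨p, hp⟩ := hcont
  have hK : IsClosedOverShifts (pointwiseClosure (GammaF f)) :=
    isClosedOverShifts_pointwiseClosure fun g hg => Subgroup.subset_closure (.inl hg)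
  have htop := hK.eq_top_of_not_continuousAt
    (le_pointwiseClosure _ (Subgroup.subset_closure (.inr rfl))) hp
  obtain ⟨g, hg⟩ := exists_realizes σ
  have hgK : g ∈ pointwiseClosure (GammaF f) := htop ▸ Subgroup.mem_top g
  obtain ⟨h, hh, e⟩ := hgK (Finset.univ.image fun i : Fin k => ((i : ℕ) : ℚ) + 1)
  refine hσ h hh fun i j => ?_
  rw [e _ (Finset.mem_image_of_mem _ (Finset.mem_univ i)),
    e _ (Finset.mem_image_of_mem _ (Finset.mem_univ j)), hg, hg]
  simp
end

section
/- For any nontrivial permutation f of ℚ, at least one of the following holds: (i) f is monotone (strictly increasing on ℚ or strictly decreasing on ℚ); (ii) there is a cut A ⊆ ℚ without rational endpoint (A nonempty, A ≠ ℚ, A downward closed, A has no greatest element, and ℚ∖A has no least element) such that f is strictly increasing on A, f is strictly increasing on ℚ∖A, and a ∈ A, b ∈ ℚ∖A implies f(a) > f(b); or (iii) the permutation x ↦ −f(x) satisfies condition (ii). -/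
/-- Condition (ii): there is a cut `A` of the rationals, without rational endpoint, such
that `f` is strictly increasing on `A` and on its complement, and every element of `A` is
mapped above every element of the complement. -/
def CutCondition (f : Equiv.Perm ℚ) : Prop :=
  ∃ A : Set ℚ,
    A.Nonempty ∧ A ≠ Set.univ ∧
    (∀ x ∈ A, ∀ y : ℚ, y < x → y ∈ A) ∧
    (∀ x ∈ A, ∃ y ∈ A, x < y) ∧
    (∀ x ∈ Aᶜ, ∃ y ∈ Aᶜ, y < x) ∧
    StrictMonoOn f A ∧ StrictMonoOn f Aᶜ ∧
    ∀ a ∈ A, ∀ b ∈ Aᶜ, f b < f a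

/-- A finite strictly increasing partial map of `ℚ` extends to a shift. -/
theorem exists_shift_eqOn (s : Finset ℚ) (φ : ℚ → ℚ) (h : StrictMonoOn φ s) :
    ∃ g ∈ Shifts, ∀ a ∈ s, g a = φ a := by
  induction s using Finset.induction_on_max with
  | empty => exact ⟨1, strictMono_id, by simp⟩
  | insert b s hb ih =>
    obtain ⟨g, hg, hgs⟩ := ih (h.mono (by simp))
    rcases s.eq_empty_or_nonempty with rfl | hne
    · refine ⟨Equiv.addRight (φ b - b), fun x y hxy => ?_, by simp⟩
      simpa using hxy
    · have hc := s.max'_mem hne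
      set c := s.max' hne with hcdef
      have hcb : g c < g b := hg (hb c hc)
      have hφ : g c < φ b := by
        rw [hgs c hc]
        exact h (by simp [hc]) (by simp) (hb c hc)
      set r : ℚ := (φ b - g c) / (g b - g c) with hr
      have hr0 : 0 < r := div_pos (by linarith) (by linarith)
      let k : Equiv.Perm ℚ :=
        { toFun := fun t => if t ≤ g c then t else g c + (t - g c) * r
          invFun := fun t => if t ≤ g c then t else g c + (t - g c) / r
          left_inv := fun t => by
            by_cases ht : t ≤ g c
            · simp [ht]
            · have : 0 < (t - g c) * r := mul_pos (by linarith) hr0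
              have h2 : ¬ g c + (t - g c) * r ≤ g c := by linarith
              simp only [ht, h2, if_false]
              field_simp
              ring
          right_inv := fun t => by
            by_cases ht : t ≤ g c
            · simp [ht]
            · have : 0 < (t - g c) / r := div_pos (by linarith) hr0
              have h2 : ¬ g c + (t - g c) / r ≤ g c := by linarith
              simp only [ht, h2, if_false]
              field_simp
              ring }
      have hk : ∀ t, k t = if t ≤ g c then t else g c + (t - g c) * r := fun t => rfl
      have hkm : StrictMono k := by
        intro u v huv
        rw [hk, hk]
        split_ifs with h1 h2 h2
        · exact huv
        · have : 0 < (v - g c) * r := mul_pos (by linarith) hr0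
          linarith
        · linarith
        · have := mul_lt_mul_of_pos_right (sub_lt_sub_right huv (g c)) hr0
          linarith
      refine ⟨k * g, hkm.comp hg, fun a ha => ?_⟩
      rw [Equiv.Perm.mul_apply, hk]
      rcases Finset.mem_insert.1 ha with rfl | ha
      · rw [if_neg (not_le.2 hcb), hr, mul_div_cancel₀ _ (by linarith)]
        ring
      · rw [if_pos (hg.monotone (s.le_max' a ha)), hgs a ha]

/-- Only the order pattern of the images matters for a group containing all shifts. -/
theorem exists_mem_eqOn {H : Subgroup (Equiv.Perm ℚ)} (hH : Shifts ⊆ H) {g : Equiv.Perm ℚ}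
    (hg : g ∈ H) (s : Finset ℚ) (φ : ℚ → ℚ)
    (h : ∀ a ∈ s, ∀ b ∈ s, g a < g b → φ a < φ b) :
    ∃ k ∈ H, ∀ a ∈ s, k a = φ a := by
  obtain ⟨γ, hγ, h2⟩ := exists_shift_eqOn (s.image g) (fun x => φ (g.symm x)) (by
    intro x hx y hy hxy
    simp only [Finset.coe_image, Set.mem_image, Finset.mem_coe] at hx hy
    obtain ⟨a, ha, rfl⟩ := hx
    obtain ⟨b, hb, rfl⟩ := hy
    simpa using h a ha b hb hxy)
  refine ⟨γ * g, H.mul_mem (hH hγ) hg, fun a ha => ?_⟩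
  simpa using h2 (g a) (Finset.mem_image_of_mem _ ha)

/-- The number of elements of `s` below `x`. -/
def finRank (s : Finset ℚ) (x : ℚ) : ℕ := (s.filter (· < x)).card

theorem finRank_lt_finRank {s : Finset ℚ} {x y : ℚ} (hx : x ∈ s) (hxy : x < y) :
    finRank s x < finRank s y := by
  apply Finset.card_lt_card
  rw [Finset.ssubset_iff_of_subset]
  · exact ⟨x, by simp [hx, hxy], by simp⟩
  · intro z hz
    simp only [Finset.mem_filter] at hz ⊢
    exact ⟨hz.1, hz.2.trans hxy⟩

theorem finRank_le_card (s : Finset ℚ) (x : ℚ) : finRank s x ≤ s.card :=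
  Finset.card_filter_le _ _

/-- Some element of `H` acts on `s` as the transposition of `x` and `y`. -/
def SwapOn (H : Subgroup (Equiv.Perm ℚ)) (s : Finset ℚ) (x y : ℚ) : Prop :=
  ∃ g ∈ H, ∀ a ∈ s, g a = Equiv.swap x y a

namespace SwapOn

variable {H : Subgroup (Equiv.Perm ℚ)} {s : Finset ℚ} {x y z : ℚ}

theorem refl (H : Subgroup (Equiv.Perm ℚ)) (s : Finset ℚ) (x : ℚ) : SwapOn H s x x :=
  ⟨1, H.one_mem, by simp⟩

theorem symm (h : SwapOn H s x y) : SwapOn H s y x := by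
  obtain ⟨g, hg, h⟩ := h
  exact ⟨g, hg, fun a ha => by rw [h a ha, Equiv.swap_comm]⟩

theorem swap_mem (hx : x ∈ s) (hy : y ∈ s) {a : ℚ} (ha : a ∈ s) : Equiv.swap x y a ∈ s := by
  rw [Equiv.swap_apply_def]
  split_ifs <;> assumption

theorem trans (hx : x ∈ s) (hy : y ∈ s) (hz : z ∈ s) (h₁ : SwapOn H s x y)
    (h₂ : SwapOn H s y z) : SwapOn H s x z := by
  by_cases hxy : x = y
  · exact hxy ▸ h₂
  by_cases hxz : x = z
  · exact hxz ▸ refl H s x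
  obtain ⟨g, hg, h₁⟩ := h₁
  obtain ⟨k, hk, h₂⟩ := h₂
  refine ⟨k * g * k, H.mul_mem (H.mul_mem hk hg) hk, fun a ha => ?_⟩
  have e := Equiv.swap_mul_swap_mul_swap hxy hxz
  rw [Equiv.swap_comm x z, ← e]
  simp only [Equiv.Perm.mul_apply]
  have m1 := swap_mem hy hz ha
  rw [h₂ a ha, h₁ _ m1, h₂ _ (swap_mem hx hy m1)]

theorem of_image {g : Equiv.Perm ℚ} (hg : g ∈ H) (h : SwapOn H (s.image g) (g x) (g y)) :
    SwapOn H s x y := by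
  obtain ⟨k, hk, h⟩ := h
  refine ⟨g⁻¹ * k * g, H.mul_mem (H.mul_mem (H.inv_mem hg) hk) hg, fun a ha => ?_⟩
  simp only [Equiv.Perm.mul_apply]
  rw [h _ (Finset.mem_image_of_mem _ ha), Equiv.Perm.inv_eq_iff_eq]
  simp only [Equiv.swap_apply_def, g.injective.eq_iff]
  split_ifs <;> rfl

/-- If the elements of rank less than `m` can be permuted freely in every finite set, then so can
those of rank less than `m + 1`. -/
theorem of_finRank_lt_succ {m : ℕ} (hm : 2 ≤ m)
    (h : ∀ (s : Finset ℚ) (x y : ℚ), x ∈ s → y ∈ s → finRank s x < m → finRank s y < m →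
      SwapOn H s x y) :
    ∀ (s : Finset ℚ) (x y : ℚ), x ∈ s → y ∈ s → finRank s x < m + 1 → finRank s y < m + 1 →
      SwapOn H s x y := by
  intro s
  have key : ∀ y ∈ s, finRank s y = m → ∃ x ∈ s, finRank s x < m ∧ SwapOn H s x y := by
    intro y hy hym
    have hne : s.Nonempty := ⟨y, hy⟩
    obtain ⟨z, hz, hzmin⟩ : ∃ z ∈ s, ∀ a ∈ s, z ≤ a :=
      ⟨s.min' hne, s.min'_mem hne, fun a ha => s.min'_le a ha⟩
    have hone : 1 < (s.filter (· < y)).card := by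
      change 1 < finRank s y
      omega
    obtain ⟨x, hx, hxz⟩ := Finset.exists_mem_ne hone z
    rw [Finset.mem_filter] at hx
    obtain ⟨hx, hxy⟩ := hx
    have hzx : z < x := lt_of_le_of_ne (hzmin x hx) (Ne.symm hxz)
    have hzy := hzx.trans hxy
    have hrank : ∀ t, z < t → finRank (s.erase z) t + 1 = finRank s t := by
      intro t ht
      unfold finRank
      rw [Finset.filter_erase]
      exact Finset.card_erase_add_one (by simp [hz, ht])
    have hxm := finRank_lt_finRank hx hxy
    have e1 := hrank x hzx
    have e2 := hrank y hzy
    obtain ⟨g, hg, hgs⟩ := h (s.erase z) x y (by simp [hx, hxz]) (by simp [hy, hzy.ne'])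
      (by omega) (by omega)
    have gx : g x = y := by rw [hgs x (by simp [hx, hxz]), Equiv.swap_apply_left]
    have gy : g y = x := by rw [hgs y (by simp [hy, hzy.ne']), Equiv.swap_apply_right]
    have hsub : s.image g ⊆ insert (g z) (s.erase z) := by
      intro b hb
      obtain ⟨a, ha, rfl⟩ := Finset.mem_image.1 hb
      by_cases haz : a = z
      · simp [haz]
      · have ha' : a ∈ s.erase z := by simp [ha, haz]
        rw [hgs a ha']
        exact Finset.mem_insert_of_mem
          (swap_mem (by simp [hx, hxz]) (by simp [hy, hzy.ne']) ha')
    have mem : ∀ a ∈ s, g a ∈ s.image g := fun a ha => Finset.mem_image_of_mem _ ha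
    have r1 : ∀ t, finRank (s.image g) t ≤ finRank (s.erase z) t + 1 := by
      intro t
      refine (Finset.card_le_card (Finset.filter_subset_filter _ hsub)).trans ?_
      rw [Finset.filter_insert]
      split_ifs
      · exact Finset.card_insert_le _ _
      · exact Nat.le_succ _
    have r2 : ∀ t, t ≤ g z → finRank (s.image g) t ≤ finRank (s.erase z) t := by
      intro t ht
      refine (Finset.card_le_card (Finset.filter_subset_filter _ hsub)).trans ?_
      rw [Finset.filter_insert, if_neg (not_lt.2 ht)]
      rfl
    have mono : ∀ t u, t ≤ u → finRank (s.erase z) t ≤ finRank (s.erase z) u := by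
      intro t u htu
      apply Finset.card_le_card
      intro a ha
      simp only [Finset.mem_filter] at ha ⊢
      exact ⟨ha.1, ha.2.trans_le htu⟩
    rcases le_or_gt y (g z) with hw | hw
    · refine ⟨x, hx, by omega, of_image hg (h _ _ _ (mem x hx) (mem y hy) ?_ ?_)⟩
      · have := r2 (g x) (by rw [gx]; exact hw)
        rw [gx] at this ⊢
        omega
      · have := r2 (g y) (by rw [gy]; exact hxy.le.trans hw)
        rw [gy] at this ⊢
        omega
    · refine ⟨z, hz, ?_, of_image hg (h _ _ _ (mem z hz) (mem y hy) ?_ ?_)⟩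
      · have := finRank_lt_finRank hz hzy
        omega
      · have := r2 (g z) le_rfl
        have := mono (g z) y hw.le
        omega
      · have := r1 (g y)
        rw [gy] at this ⊢
        omega
  have low : ∀ y ∈ s, finRank s y < m + 1 → ∃ x ∈ s, finRank s x < m ∧ SwapOn H s x y := by
    intro y hy hym
    by_cases hlt : finRank s y < m
    · exact ⟨y, hy, hlt, refl H s y⟩
    · exact key y hy (by omega)
  intro x y hx hy hxm hym
  obtain ⟨x', hx', hxm', h1⟩ := low x hx hxm
  obtain ⟨y', hy', hym', h2⟩ := low y hy hym
  exact (h1.symm.trans hx hx' hy' (h s x' y' hx' hy' hxm' hym')).trans hx hy' hy h2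

/-- If the two least elements of every finite set can be swapped, all elements can. -/
theorem of_two_least
    (h : ∀ (s : Finset ℚ) (x y : ℚ), x < y → (∀ a ∈ s, a = x ∨ a = y ∨ y < a) → SwapOn H s x y)
    (s : Finset ℚ) (hx : x ∈ s) (hy : y ∈ s) : SwapOn H s x y := by
  have all : ∀ m, ∀ (s : Finset ℚ) (x y : ℚ), x ∈ s → y ∈ s →
      finRank s x < m + 2 → finRank s y < m + 2 → SwapOn H s x y := by
    intro m
    induction m with
    | zero =>
      intro s
      have main : ∀ x y, x ∈ s → y ∈ s → finRank s y < 2 → x < y → SwapOn H s x y := by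
        intro x y hx hy hym hxy
        have hxm := finRank_lt_finRank hx hxy
        refine h s x y hxy fun a ha => ?_
        by_contra! hcon
        obtain ⟨h1, h2, h3⟩ := hcon
        have h4 := finRank_lt_finRank ha (lt_of_le_of_ne h3 h2)
        rcases lt_or_gt_of_ne h1 with h5 | h5
        · have := finRank_lt_finRank ha h5
          omega
        · have := finRank_lt_finRank hx h5
          omega
      intro x y hx hy hxm hym
      rcases lt_trichotomy x y with hxy | rfl | hxy
      · exact main x y hx hy hym hxy
      · exact refl H s x
      · exact (main y x hy hx hxm hxy).symm
    | succ m ih => exact of_finRank_lt_succ (by omega) ih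
  have := finRank_le_card s x
  have := finRank_le_card s y
  exact all s.card s x y hx hy (by omega) (by omega)

end SwapOn

theorem exists_realizes_of_swapOn {H : Subgroup (Equiv.Perm ℚ)}
    (h : ∀ (s : Finset ℚ) (x y : ℚ), x ∈ s → y ∈ s → SwapOn H s x y) {k : ℕ}
    (σ : Equiv.Perm (Fin k)) : ∃ g ∈ H, Realizes g σ := by
  suffices key : ∃ g ∈ H, ∀ i : Fin k, g (((i : ℕ) : ℚ) + 1) = ((σ i : ℕ) : ℚ) + 1 by
    obtain ⟨g, hg, hgi⟩ := key
    exact ⟨g, hg, fun i j => by simp [hgi]⟩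
  induction σ using Equiv.Perm.swap_induction_on with
  | one => exact ⟨1, H.one_mem, by simp⟩
  | swap_mul σ x y hxy ih =>
    obtain ⟨g, hg, hgi⟩ := ih
    set c : Fin k → ℚ := fun i => ((i : ℕ) : ℚ) + 1 with hc
    have cinj : Function.Injective c := fun i j hij => by simpa [hc, Fin.val_inj] using hij
    obtain ⟨t, ht, hts⟩ := h (Finset.univ.image c) (c x) (c y) (by simp) (by simp)
    refine ⟨t * g, H.mul_mem ht hg, fun i => ?_⟩
    have e : t (c (σ i)) = c (Equiv.swap x y (σ i)) := by
      rw [hts _ (by simp)]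
      simp only [Equiv.swap_apply_def, cinj.eq_iff]
      split_ifs <;> rfl
    simpa [hgi i] using e

theorem swapOn_of_descent {H : Subgroup (Equiv.Perm ℚ)} (hH : Shifts ⊆ H) {a b : ℚ} {v : ℕ → ℚ}
    (hab : a < b) (hv : StrictMono v) (hbv : ∀ n, b < v n)
    (h : ∀ n : ℕ, ∃ k ∈ H, k b < k a ∧ (∀ i ≤ n, k a < k (v i)) ∧
      ∀ i j, i < j → j ≤ n → k (v i) < k (v j))
    (s : Finset ℚ) (x y : ℚ) (hxy : x < y) (hs : ∀ z ∈ s, z = x ∨ z = y ∨ y < z) :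
    SwapOn H s x y := by
  obtain ⟨k, hk, hba, hav, hvv⟩ := h s.card
  set φ : ℚ → ℚ := fun z => if z = x then a else if z = y then b else v (finRank s z) with hφ
  have φx : φ x = a := by simp [hφ]
  have φy : φ y = b := by simp [hφ, hxy.ne']
  have φz : ∀ z, y < z → φ z = v (finRank s z) := fun z hz => by
    simp [hφ, hz.ne', (hxy.trans hz).ne']
  obtain ⟨γ, hγ, hγs⟩ := exists_shift_eqOn s φ (by
    intro p hp q hq hpq
    rcases hs p hp with rfl | rfl | hp' <;> rcases hs q hq with rfl | rfl | hq'
    · exact absurd hpq (lt_irrefl _)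
    · rw [φx, φy]; exact hab
    · rw [φx, φz q hq']; exact hab.trans (hbv _)
    · exact absurd hpq hxy.not_gt
    · exact absurd hpq (lt_irrefl _)
    · rw [φy, φz q hq']; exact hbv _
    · exact absurd hpq (hxy.trans hp').not_gt
    · exact absurd hpq hp'.not_gt
    · rw [φz p hp', φz q hq']; exact hv (finRank_lt_finRank hp hpq))
  refine exists_mem_eqOn hH (H.mul_mem hk (hH hγ)) s (Equiv.swap x y) ?_
  have sz : ∀ z, y < z → Equiv.swap x y z = z := fun z hz =>
    Equiv.swap_apply_of_ne_of_ne (hxy.trans hz).ne' hz.ne'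
  intro p hp q hq hpq
  rw [Equiv.Perm.mul_apply, Equiv.Perm.mul_apply, hγs p hp, hγs q hq] at hpq
  rcases hs p hp with rfl | rfl | hp' <;> rcases hs q hq with rfl | rfl | hq'
  · exact absurd hpq (lt_irrefl _)
  · rw [φx, φy] at hpq
    exact absurd hpq hba.not_gt
  · rw [Equiv.swap_apply_left, sz q hq']; exact hq'
  · simpa using hxy
  · exact absurd hpq (lt_irrefl _)
  · rw [Equiv.swap_apply_right, sz q hq']; exact hxy.trans hq'
  · rw [φx, φz p hp'] at hpq
    exact absurd hpq (hav _ (finRank_le_card _ _)).not_gt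
  · rw [φy, φz p hp'] at hpq
    exact absurd hpq (hba.trans (hav _ (finRank_le_card _ _))).not_gt
  · rw [sz p hp', sz q hq']
    rw [φz p hp', φz q hq'] at hpq
    by_contra hcon
    rcases eq_or_lt_of_le (not_lt.1 hcon) with rfl | hlt
    · exact absurd hpq (lt_irrefl _)
    · exact absurd hpq (hvv _ _ (finRank_lt_finRank hq hlt) (finRank_le_card _ _)).not_gt

/-- The function `F` is a pointwise limit of elements of `H`. -/
def Approx (H : Subgroup (Equiv.Perm ℚ)) (F : ℚ → ℚ) : Prop :=
  ∀ s : Finset ℚ, ∃ g ∈ H, ∀ a ∈ s, g a = F a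

/-- The greatest element of any finite set can be moved below all others by an element of `H`
that keeps the order of the others. -/
def MaxToBottom (H : Subgroup (Equiv.Perm ℚ)) : Prop :=
  ∀ (s : Finset ℚ) (m : ℚ), (∀ z ∈ s, z < m) →
    ∃ g ∈ H, (∀ x ∈ s, ∀ y ∈ s, x < y → g x < g y) ∧ ∀ z ∈ s, g m < g z

theorem maxToBottom_of_approx {H : Subgroup (Equiv.Perm ℚ)} (hH : Shifts ⊆ H) {F : ℚ → ℚ}
    (hF : Approx H F) {c : ℚ} {v : ℕ → ℚ} (hv : StrictMono v) (hcv : ∀ n, c < v n)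
    (hFv : StrictMono (F ∘ v)) (hFc : ∀ n, F (v n) < F c) : MaxToBottom H := by
  intro s m hm
  obtain ⟨g, hg, hgs⟩ := hF (insert c ((Finset.range (s.card + 1)).image v))
  have gc : g c = F c := hgs c (by simp)
  have gv : ∀ i ≤ s.card, g (v i) = F (v i) := fun i hi =>
    hgs _ (Finset.mem_insert_of_mem (Finset.mem_image_of_mem _ (by simpa using by omega)))
  set φ : ℚ → ℚ := fun z => if z = m then F c else F (v (finRank s z)) with hφ
  have φm : φ m = F c := by simp [hφ]
  have φz : ∀ z ∈ s, φ z = F (v (finRank s z)) := fun z hz => by simp [hφ, (hm z hz).ne]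
  obtain ⟨γ, hγ, hγs⟩ := exists_shift_eqOn (insert m s) φ (by
    intro p hp q hq hpq
    rw [Finset.mem_coe, Finset.mem_insert] at hp hq
    rcases hp with rfl | hp <;> rcases hq with rfl | hq
    · exact absurd hpq (lt_irrefl _)
    · exact absurd hpq (hm q hq).not_gt
    · rw [φm, φz p hp]; exact hFc _
    · rw [φz p hp, φz q hq]; exact hFv (finRank_lt_finRank hp hpq))
  have em : (g⁻¹ * γ) m = c := by
    rw [Equiv.Perm.mul_apply, hγs m (by simp), φm, Equiv.Perm.inv_eq_iff_eq, gc]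
  have ez : ∀ z ∈ s, (g⁻¹ * γ) z = v (finRank s z) := fun z hz => by
    rw [Equiv.Perm.mul_apply, hγs z (by simp [hz]), φz z hz, Equiv.Perm.inv_eq_iff_eq,
      gv _ (finRank_le_card _ _)]
  refine ⟨g⁻¹ * γ, H.mul_mem (H.inv_mem hg) (hH hγ), fun x hx y hy hxy => ?_, fun z hz => ?_⟩
  · rw [ez x hx, ez y hy]
    exact hv (finRank_lt_finRank hx hxy)
  · rw [em, ez z hz]
    exact hcv _

/-- The cyclic order of `a, b, c, d` agrees with that of four increasing numbers. -/
def IsRotation (a b c d : ℚ) : Prop :=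
  (a < b ∧ b < c ∧ c < d) ∨ (b < c ∧ c < d ∧ d < a) ∨ (c < d ∧ d < a ∧ a < b) ∨
    (d < a ∧ a < b ∧ b < c)

/-- An approximable function that violates the cyclic order of four points and is increasing on a
sequence above them gives all transpositions of the two least elements of finite sets. -/
theorem swapOn_of_not_isRotation {H : Subgroup (Equiv.Perm ℚ)} (hH : Shifts ⊆ H) {F : ℚ → ℚ}
    (hF : Approx H F) (hFi : Function.Injective F) {x₁ x₂ x₃ x₄ : ℚ} (h₁₂ : x₁ < x₂) (h₂₃ : x₂ < x₃)
    (h₃₄ : x₃ < x₄) {v : ℕ → ℚ} (hv : StrictMono v) (hxv : ∀ n, x₄ < v n)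
    (hFv : StrictMono (F ∘ v))
    (hsep : ∀ x, x = x₁ ∨ x = x₂ ∨ x = x₃ ∨ x = x₄ →
      (∀ n, F x < F (v n)) ∨ ∀ n, F (v n) < F x)
    (hbad : ¬ IsRotation (F x₁) (F x₂) (F x₃) (F x₄))
    (s : Finset ℚ) (x y : ℚ) (hxy : x < y) (hs : ∀ z ∈ s, z = x ∨ z = y ∨ y < z) :
    SwapOn H s x y := by
  by_contra hcon
  have hdesc : ∀ a b, a < b → (∀ n, b < v n) → ¬ ∀ n : ℕ, ∃ k ∈ H, k b < k a ∧
      (∀ i ≤ n, k a < k (v i)) ∧ ∀ i j, i < j → j ≤ n → k (v i) < k (v j) :=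
    fun a b hab hb h => hcon (swapOn_of_descent hH hab hv hb h s x y hxy hs)
  have approx : ∀ a b n, ∃ g ∈ H, g a = F a ∧ g b = F b ∧ ∀ i ≤ n, g (v i) = F (v i) := by
    intro a b n
    obtain ⟨g, hg, hgs⟩ := hF (insert a (insert b ((Finset.range (n + 1)).image v)))
    refine ⟨g, hg, hgs a (by simp), hgs b (by simp), fun i hi => hgs _ ?_⟩
    simp only [Finset.mem_insert, Finset.mem_image, Finset.mem_range]
    exact Or.inr (Or.inr ⟨i, by omega, rfl⟩)
  have hLL : ∀ a b, a < b → (∀ n, b < v n) → (∀ n, F a < F (v n)) → (∀ n, F b < F (v n)) →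
      F a < F b := by
    intro a b hab hb ha' hb'
    by_contra hlt
    have hlt : F b < F a := lt_of_le_of_ne (not_lt.1 hlt) (hFi.ne hab.ne')
    refine hdesc a b hab hb fun n => ?_
    obtain ⟨g, hg, ga, gb, gv⟩ := approx a b n
    refine ⟨g, hg, by rwa [ga, gb], fun i hi => ?_, fun i j hij hj => ?_⟩
    · rw [ga, gv i hi]; exact ha' i
    · rw [gv i (by omega), gv j hj]; exact hFv hij
  have hLU : ∀ a b, a < b → (∀ n, b < v n) → (∀ n, F a < F (v n)) → ¬ ∀ n, F (v n) < F b := by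
    intro a b hab hb ha' hb'
    have hM := maxToBottom_of_approx hH hF hv hb hFv hb'
    refine hdesc a b hab hb fun n => ?_
    obtain ⟨g, hg, ga, gb, gv⟩ := approx a b n
    obtain ⟨k, hk, hk1, hk2⟩ := hM (insert (F a) ((Finset.range (n + 1)).image (F ∘ v))) (F b) (by
      intro z hz
      simp only [Finset.mem_insert, Finset.mem_image] at hz
      rcases hz with rfl | ⟨i, -, rfl⟩
      · exact (ha' 0).trans (hb' 0)
      · exact hb' i)
    have mv : ∀ i ≤ n, F (v i) ∈ insert (F a) ((Finset.range (n + 1)).image (F ∘ v)) :=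
      fun i hi => Finset.mem_insert_of_mem
        (Finset.mem_image.2 ⟨i, Finset.mem_range.2 (by omega), rfl⟩)
    have ma : F a ∈ insert (F a) ((Finset.range (n + 1)).image (F ∘ v)) :=
      Finset.mem_insert_self _ _
    refine ⟨k * g, H.mul_mem hk hg, ?_, fun i hi => ?_, fun i j hij hj => ?_⟩
    · simp only [Equiv.Perm.mul_apply, ga, gb]
      exact hk2 _ ma
    · simp only [Equiv.Perm.mul_apply, ga, gv i hi]
      exact hk1 _ ma _ (mv i hi) (ha' i)
    · simp only [Equiv.Perm.mul_apply, gv i (hij.le.trans hj), gv j hj]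
      exact hk1 _ (mv i (by omega)) _ (mv j hj) (hFv hij)
  have hUU : ∀ a b, a < b → (∀ n, b < v n) → (∀ n, F (v n) < F a) → (∀ n, F (v n) < F b) →
      F a < F b := by
    intro a b hab hb ha' hb'
    by_contra hlt
    have hlt : F b < F a := lt_of_le_of_ne (not_lt.1 hlt) (hFi.ne hab.ne')
    have hM := maxToBottom_of_approx hH hF hv hb hFv hb'
    refine hdesc a b hab hb fun n => ?_
    obtain ⟨g, hg, ga, gb, gv⟩ := approx a b n
    obtain ⟨k, hk, hk1, hk2⟩ := hM (insert (F b) ((Finset.range (n + 1)).image (F ∘ v))) (F a) (by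
      intro z hz
      simp only [Finset.mem_insert, Finset.mem_image] at hz
      rcases hz with rfl | ⟨i, -, rfl⟩
      · exact hlt
      · exact ha' i)
    have mv : ∀ i ≤ n, F (v i) ∈ insert (F b) ((Finset.range (n + 1)).image (F ∘ v)) :=
      fun i hi => Finset.mem_insert_of_mem
        (Finset.mem_image.2 ⟨i, Finset.mem_range.2 (by omega), rfl⟩)
    have mb : F b ∈ insert (F b) ((Finset.range (n + 1)).image (F ∘ v)) :=
      Finset.mem_insert_self _ _
    obtain ⟨l, hl, hl1, hl2⟩ := hM
      (insert (k (F a)) ((Finset.range (n + 1)).image (k ∘ F ∘ v))) (k (F b)) (by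
      intro z hz
      simp only [Finset.mem_insert, Finset.mem_image, Finset.mem_range] at hz
      rcases hz with rfl | ⟨i, hi, rfl⟩
      · exact hk2 _ mb
      · exact hk1 _ (mv i (by omega)) _ mb (hb' i))
    have mv' : ∀ i ≤ n, k (F (v i)) ∈
        insert (k (F a)) ((Finset.range (n + 1)).image (k ∘ F ∘ v)) :=
      fun i hi => Finset.mem_insert_of_mem
        (Finset.mem_image.2 ⟨i, Finset.mem_range.2 (by omega), rfl⟩)
    have ma' : k (F a) ∈ insert (k (F a)) ((Finset.range (n + 1)).image (k ∘ F ∘ v)) :=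
      Finset.mem_insert_self _ _
    refine ⟨l * (k * g), H.mul_mem hl (H.mul_mem hk hg), ?_, fun i hi => ?_,
      fun i j hij hj => ?_⟩
    · simp only [Equiv.Perm.mul_apply, ga, gb]
      exact hl2 _ ma'
    · simp only [Equiv.Perm.mul_apply, ga, gv i hi]
      exact hl1 _ ma' _ (mv' i hi) (hk2 _ (mv i hi))
    · simp only [Equiv.Perm.mul_apply, gv i (hij.le.trans hj), gv j hj]
      exact hl1 _ (mv' i (by omega)) _ (mv' j hj) (hk1 _ (mv i (by omega)) _ (mv j hj) (hFv hij))
  have b₃ : ∀ n, x₃ < v n := fun n => h₃₄.trans (hxv n)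
  have b₂ : ∀ n, x₂ < v n := fun n => h₂₃.trans (b₃ n)
  have ul : ∀ a b, (∀ n, F (v n) < F a) → (∀ n, F b < F (v n)) → F b < F a :=
    fun a b ha hb => (hb 0).trans (ha 0)
  apply hbad
  unfold IsRotation
  rcases hsep x₁ (by simp) with s₁ | s₁
  · have s₂ := (hsep x₂ (by simp)).resolve_right (hLU x₁ x₂ h₁₂ b₂ s₁)
    have s₃ := (hsep x₃ (by simp)).resolve_right (hLU x₂ x₃ h₂₃ b₃ s₂)
    have s₄ := (hsep x₄ (by simp)).resolve_right (hLU x₃ x₄ h₃₄ hxv s₃)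
    exact Or.inl ⟨hLL _ _ h₁₂ b₂ s₁ s₂, hLL _ _ h₂₃ b₃ s₂ s₃, hLL _ _ h₃₄ hxv s₃ s₄⟩
  rcases hsep x₂ (by simp) with s₂ | s₂
  · have s₃ := (hsep x₃ (by simp)).resolve_right (hLU x₂ x₃ h₂₃ b₃ s₂)
    have s₄ := (hsep x₄ (by simp)).resolve_right (hLU x₃ x₄ h₃₄ hxv s₃)
    exact Or.inr (Or.inl ⟨hLL _ _ h₂₃ b₃ s₂ s₃, hLL _ _ h₃₄ hxv s₃ s₄, ul _ _ s₁ s₄⟩)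
  have o₁₂ := hUU _ _ h₁₂ b₂ s₁ s₂
  rcases hsep x₃ (by simp) with s₃ | s₃
  · have s₄ := (hsep x₄ (by simp)).resolve_right (hLU x₃ x₄ h₃₄ hxv s₃)
    exact Or.inr (Or.inr (Or.inl ⟨hLL _ _ h₃₄ hxv s₃ s₄, ul _ _ s₁ s₄, o₁₂⟩))
  have o₂₃ := hUU _ _ h₂₃ b₃ s₂ s₃
  rcases hsep x₄ (by simp) with s₄ | s₄
  · exact Or.inr (Or.inr (Or.inr ⟨ul _ _ s₁ s₄, o₁₂, o₂₃⟩))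
  · exact Or.inl ⟨o₁₂, o₂₃, hUU _ _ h₃₄ hxv s₃ s₄⟩

/-- The same without the assumption that the sequence is separated from the four points. -/
theorem swapOn_of_strictMono_comp {H : Subgroup (Equiv.Perm ℚ)} (hH : Shifts ⊆ H) {F : ℚ → ℚ}
    (hF : Approx H F) (hFi : Function.Injective F) {x₁ x₂ x₃ x₄ : ℚ} (h₁₂ : x₁ < x₂) (h₂₃ : x₂ < x₃)
    (h₃₄ : x₃ < x₄) {v : ℕ → ℚ} (hv : StrictMono v) (hxv : ∀ n, x₄ < v n)
    (hFv : StrictMono (F ∘ v)) (hbad : ¬ IsRotation (F x₁) (F x₂) (F x₃) (F x₄))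
    (s : Finset ℚ) (x y : ℚ) (hxy : x < y) (hs : ∀ z ∈ s, z = x ∨ z = y ∨ y < z) :
    SwapOn H s x y := by
  have tail : ∀ c, c < v 0 → ∃ N, (∀ n, N ≤ n → F c < F (v n)) ∨ ∀ n, F (v n) < F c := by
    intro c hc
    by_cases h : ∃ N, F c < F (v N)
    · obtain ⟨N, hN⟩ := h
      exact ⟨N, Or.inl fun n hn => hN.trans_le (hFv.monotone hn)⟩
    · push Not at h
      exact ⟨0, Or.inr fun n => lt_of_le_of_ne (h n)
        (hFi.ne (hc.trans_le (hv.monotone (Nat.zero_le n))).ne')⟩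
  have c₄ := hxv 0
  obtain ⟨N₁, t₁⟩ := tail x₁ (by linarith)
  obtain ⟨N₂, t₂⟩ := tail x₂ (by linarith)
  obtain ⟨N₃, t₃⟩ := tail x₃ (by linarith)
  obtain ⟨N₄, t₄⟩ := tail x₄ c₄
  have shift : StrictMono fun n : ℕ => n + (N₁ + N₂ + N₃ + N₄) :=
    fun a b hab => Nat.add_lt_add_right hab _
  refine swapOn_of_not_isRotation hH hF hFi h₁₂ h₂₃ h₃₄ (hv.comp shift) (fun n => hxv _)
    (hFv.comp shift) ?_ hbad s x y hxy hs
  rintro c (rfl | rfl | rfl | rfl)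
  · exact t₁.imp (fun h n => h _ (by dsimp only; omega)) (fun h n => h _)
  · exact t₂.imp (fun h n => h _ (by dsimp only; omega)) (fun h n => h _)
  · exact t₃.imp (fun h n => h _ (by dsimp only; omega)) (fun h n => h _)
  · exact t₄.imp (fun h n => h _ (by dsimp only; omega)) (fun h n => h _)

/-- If an element of `H` is decreasing on some increasing sequence, then `H` contains elements
reversing the order of any finite set. -/
theorem approx_neg {H : Subgroup (Equiv.Perm ℚ)} (hH : Shifts ⊆ H) {f : Equiv.Perm ℚ} (hf : f ∈ H)
    {v : ℕ → ℚ} (hv : StrictMono v) (hfv : StrictAnti (f ∘ v)) : Approx H (fun x => -x) := by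
  intro s
  obtain ⟨γ, hγ, hγs⟩ := exists_shift_eqOn s (fun z => v (finRank s z))
    fun p hp q _ hpq => hv (finRank_lt_finRank hp hpq)
  refine exists_mem_eqOn hH (H.mul_mem hf (hH hγ)) s _ fun p hp q hq hpq => ?_
  rw [Equiv.Perm.mul_apply, Equiv.Perm.mul_apply, hγs p hp, hγs q hq] at hpq
  have := hfv.lt_iff_gt.1 hpq
  rw [neg_lt_neg_iff]
  by_contra hle
  rcases eq_or_lt_of_le (not_lt.1 hle) with rfl | hlt
  · exact lt_irrefl _ hpq
  · exact this.not_gt (finRank_lt_finRank hp hlt)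

theorem isRotation_of_nontrivial {f : Equiv.Perm ℚ} (hf : Nontrivial' f) {x₁ x₂ x₃ x₄ : ℚ}
    (h₁₂ : x₁ < x₂) (h₂₃ : x₂ < x₃) (h₃₄ : x₃ < x₄) :
    IsRotation (f x₁) (f x₂) (f x₃) (f x₄) ∨ IsRotation (-f x₁) (-f x₂) (-f x₃) (-f x₄) := by
  by_contra! hbad
  have hH : Shifts ⊆ (GammaF f : Set (Equiv.Perm ℚ)) :=
    Set.subset_union_left.trans Subgroup.subset_closure
  have hfH : f ∈ GammaF f := Subgroup.subset_closure (Set.mem_union_right _ rfl)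
  obtain ⟨k, σ, hσ⟩ := hf
  suffices h : ∀ (s : Finset ℚ) (x y : ℚ), x < y → (∀ a ∈ s, a = x ∨ a = y ∨ y < a) →
      SwapOn (GammaF f) s x y by
    obtain ⟨g, hg, hgσ⟩ := exists_realizes_of_swapOn
      (fun s x y hx hy => SwapOn.of_two_least h s hx hy) σ
    exact hσ g hg hgσ
  have hu : StrictMono fun n : ℕ => x₄ + 1 + (n : ℚ) := fun m n hmn => by
    have : (m : ℚ) < n := by exact_mod_cast hmn
    dsimp only
    linarith
  obtain ⟨e, he⟩ := exists_increasing_or_nonincreasing_subseq (· < ·)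
    fun n : ℕ => f (x₄ + 1 + (n : ℚ))
  set v : ℕ → ℚ := fun n => x₄ + 1 + ((e n : ℕ) : ℚ) with hvdef
  have hv : StrictMono v := hu.comp e.strictMono
  have hxv : ∀ n, x₄ < v n := fun n => by
    have : (0 : ℚ) ≤ (e n : ℕ) := Nat.cast_nonneg _
    simp only [hvdef]
    linarith
  rcases he with he | he
  · exact swapOn_of_strictMono_comp hH (F := f) (fun s => ⟨f, hfH, fun _ _ => rfl⟩) f.injective
      h₁₂ h₂₃ h₃₄ hv hxv (fun m n hmn => he m n hmn) hbad.1
  · have hanti : StrictAnti (f ∘ v) := fun m n hmn =>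
      lt_of_le_of_ne (not_lt.1 (he m n hmn)) (f.injective.ne (hv hmn).ne')
    have hneg := approx_neg hH hfH hv hanti
    refine swapOn_of_strictMono_comp hH (F := fun x => -f x) (fun s => ?_)
      (neg_injective.comp f.injective) h₁₂ h₂₃ h₃₄ hv hxv
      (fun m n hmn => neg_lt_neg (hanti hmn)) hbad.2
    obtain ⟨g, hg, hgs⟩ := hneg (s.image f)
    exact ⟨g * f, (GammaF f).mul_mem hg hfH, fun a ha => hgs _ (Finset.mem_image_of_mem _ ha)⟩

/-- The cyclic order of `a, b, c` agrees with that of three increasing numbers. -/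
def IsRotation₃ (a b c : ℚ) : Prop :=
  (a < b ∧ b < c) ∨ (b < c ∧ c < a) ∨ (c < a ∧ a < b)

/-- A permutation that preserves the cyclic order is increasing or satisfies the cut condition. -/
theorem strictMono_or_cutCondition (f : Equiv.Perm ℚ)
    (h : ∀ x y z, x < y → y < z → IsRotation₃ (f x) (f y) (f z)) :
    StrictMono f ∨ CutCondition f := by
  by_cases hmono : StrictMono f
  · exact Or.inl hmono
  right
  have hmem : ∀ a b, a < b → (¬ ∃ c, a < c ∧ f c < f a) → f a < f b := by
    intro a b hab hn
    push Not at hn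
    exact lt_of_le_of_ne (hn b hab) (f.injective.ne hab.ne)
  have hdown : ∀ x, (∃ c, x < c ∧ f c < f x) → ∀ y < x, (∃ c, y < c ∧ f c < f y) ∧ f y < f x := by
    rintro x ⟨c, hxc, hc⟩ y hyx
    have : f c < f y ∧ f y < f x := by
      rcases h y x c hyx hxc with h | h | h
      · exact absurd h.2 hc.not_gt
      · exact absurd h.1 hc.not_gt
      · exact h
    exact ⟨⟨c, hyx.trans hxc, this.1⟩, this.2⟩
  have hcross : ∀ a, (∃ c, a < c ∧ f c < f a) → ∀ b, (¬ ∃ c, b < c ∧ f c < f b) → f b < f a := by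
    rintro a ⟨c, hac, hc⟩ b hb
    have hab : a < b := by
      rcases lt_trichotomy a b with hab | rfl | hab
      · exact hab
      · exact absurd ⟨c, hac, hc⟩ hb
      · exact absurd (hdown a ⟨c, hac, hc⟩ b hab).1 hb
    rcases lt_trichotomy b c with hbc | rfl | hbc
    · exact (hmem b c hbc hb).trans hc
    · exact hc
    · rcases h a c b hac hbc with h | h | h
      · exact absurd h.1 hc.not_gt
      · exact h.2
      · exact h.1
  obtain ⟨x₀, y₀, hxy₀, hf₀⟩ : ∃ x y, x < y ∧ f y < f x := by
    simp only [StrictMono] at hmono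
    push Not at hmono
    obtain ⟨x, y, hxy, hle⟩ := hmono
    exact ⟨x, y, hxy, lt_of_le_of_ne hle (f.injective.ne hxy.ne')⟩
  have hx₀ : ∃ c, x₀ < c ∧ f c < f x₀ := ⟨y₀, hxy₀, hf₀⟩
  refine ⟨{a | ∃ c, a < c ∧ f c < f a}, ⟨x₀, hx₀⟩, ?_, fun x hx y hyx => (hdown x hx y hyx).1,
    ?_, ?_, fun x _ y hy hxy => (hdown y hy x hxy).2, fun x hx y _ hxy => hmem x y hxy hx, hcross⟩
  · intro huniv
    have hy₀ : y₀ ∈ {a | ∃ c, a < c ∧ f c < f a} := huniv ▸ Set.mem_univ y₀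
    exact hf₀.not_gt (hdown y₀ hy₀ x₀ hxy₀).2
  · intro x hx
    by_contra! hmax
    obtain ⟨z, hz⟩ := f.surjective (f x + 1)
    have hlt : f x < f z := by linarith
    by_cases hzA : z ∈ {a | ∃ c, a < c ∧ f c < f a}
    · rcases eq_or_lt_of_le (hmax z hzA) with rfl | hzx
      · exact lt_irrefl _ hlt
      · exact hlt.not_gt (hdown x hx z hzx).2
    · exact hlt.not_gt (hcross x hx z hzA)
  · intro x hx
    by_contra! hmin
    obtain ⟨z, hz⟩ := f.surjective (f x - 1)
    have hlt : f z < f x := by linarith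
    by_cases hzA : z ∈ {a | ∃ c, a < c ∧ f c < f a}
    · exact hlt.not_gt (hcross z hzA x hx)
    · rcases eq_or_lt_of_le (hmin z hzA) with rfl | hzx
      · exact lt_irrefl _ hlt
      · exact hlt.not_gt (hmem x z hzx hx)

theorem IsRotation.left {a b c d : ℚ} (h : IsRotation a b c d) : IsRotation₃ a b c := by
  unfold IsRotation at h
  unfold IsRotation₃
  grind

theorem IsRotation.right {a b c d : ℚ} (h : IsRotation a b c d) : IsRotation₃ b c d := by
  unfold IsRotation at h
  unfold IsRotation₃
  grind

theorem IsRotation₃.not_neg {a b c : ℚ} (h : IsRotation₃ a b c) :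
    ¬ IsRotation₃ (-a) (-b) (-c) := by
  unfold IsRotation₃ at *
  grind

/-- If `f` preserves or reverses the cyclic order of every quadruple, then it does so uniformly
on all triples. -/
theorem forall_isRotation₃_or_neg {f : ℚ → ℚ}
    (h : ∀ x y z w, x < y → y < z → z < w → IsRotation (f x) (f y) (f z) (f w) ∨
      IsRotation (-f x) (-f y) (-f z) (-f w)) :
    (∀ x y z, x < y → y < z → IsRotation₃ (f x) (f y) (f z)) ∨
      ∀ x y z, x < y → y < z → IsRotation₃ (-f x) (-f y) (-f z) := by
  have orient : ∀ x y z, x < y → y < z →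
      IsRotation₃ (f x) (f y) (f z) ∨ IsRotation₃ (-f x) (-f y) (-f z) :=
    fun x y z hxy hyz => (h x y z (z + 1) hxy hyz (lt_add_one z)).imp
      IsRotation.left IsRotation.left
  have step : ∀ x y z w, x < y → y < z → z < w →
      (IsRotation₃ (f x) (f y) (f z) ↔ IsRotation₃ (f y) (f z) (f w)) := by
    intro x y z w hxy hyz hzw
    rcases h x y z w hxy hyz hzw with hr | hr
    · exact iff_of_true hr.left hr.right
    · exact iff_of_false (fun hx => hx.not_neg hr.left) (fun hx => hx.not_neg hr.right)
  have far : ∀ x y z w, x < y → y < z → z < w →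
      (IsRotation₃ (f x) (f y) (f z) ↔ IsRotation₃ (f w) (f (w + 1)) (f (w + 2))) := by
    intro x y z w hxy hyz hzw
    rw [step x y z w hxy hyz hzw, step y z w (w + 1) hyz hzw (by linarith),
      step z w (w + 1) (w + 2) hzw (by linarith) (by linarith)]
  by_cases hall : ∀ x y z, x < y → y < z → IsRotation₃ (f x) (f y) (f z)
  · exact Or.inl hall
  · push Not at hall
    obtain ⟨x, y, z, hxy, hyz, hn⟩ := hall
    refine Or.inr fun x' y' z' hxy' hyz' => (orient x' y' z' hxy' hyz').resolve_left fun hr => hn ?_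
    have h₁ := le_max_left z z'
    have h₂ := le_max_right z z'
    rw [far x y z (max z z' + 1) hxy hyz (by linarith),
      ← far x' y' z' (max z z' + 1) hxy' hyz' (by linarith)]
    exact hr

/-- For any nontrivial permutation `f` of `ℚ`: (i) `f` is monotone, or (ii) `f` satisfies
the cut condition, or (iii) `-f` satisfies the cut condition. -/
theorem nontrivial_classification (f : Equiv.Perm ℚ) (hf : Nontrivial' f) :
    (StrictMono ⇑f ∨ StrictAnti ⇑f) ∨ CutCondition f ∨
      CutCondition (f.trans (Equiv.neg ℚ)) := by
  rcases forall_isRotation₃_or_neg (f := f)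
    fun x y z w hxy hyz hzw => isRotation_of_nontrivial hf hxy hyz hzw with h | h
  · exact (strictMono_or_cutCondition f h).imp Or.inl Or.inl
  · rcases strictMono_or_cutCondition (f.trans (Equiv.neg ℚ)) h with h | h
    · exact Or.inl (Or.inr fun a b hab => neg_lt_neg_iff.1 (h hab))
    · exact Or.inr (Or.inr h)
end

section
/- The order relation < on ℚ is not definable from the betweenness relation b, i.e. it is not the case that b ≽ <. -/
open FirstOrder Language

/-- Language with relation symbols indexed by `ι`, where symbol `i` has arity `ar i`. -/
def multiRelLang {ι : Type} (ar : ι → ℕ) : FirstOrder.Language where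
  Functions _ := Empty
  Relations m := { i : ι // ar i = m }

/-- The structure on `M` interpreting symbol `i` as the relation `Rels i`. -/
def multiRelStructure {M : Type*} {ι : Type} {ar : ι → ℕ}
    (Rels : ∀ i, (Fin (ar i) → M) → Prop) : (multiRelLang ar).Structure M where
  funMap f := f.elim
  RelMap r x := Rels r.1 fun j => x (Fin.cast r.2 j)

/-- Language with one relation symbol, of arity `n`. -/
def relLang (n : ℕ) : FirstOrder.Language := multiRelLang (fun _ : Unit => n)

/-- `R` is definable, without parameters, by a first-order formula in the language with a
single relation symbol interpreted as `Q`. -/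
def DefinableBy {M : Type*} {n k : ℕ} (Q : (Fin n → M) → Prop)
    (R : (Fin k → M) → Prop) : Prop :=
  letI : (relLang n).Structure M := multiRelStructure (fun _ : Unit => Q)
  ∃ φ : (relLang n).Formula (Fin k), ∀ v : Fin k → M, R v ↔ φ.Realize v

/-- The order relation on `ℚ`, as a binary relation on tuples. -/
def ltRel : (Fin 2 → ℚ) → Prop := fun v => v 0 < v 1

/-- The betweenness relation `b` on `ℚ`. -/
def bRel : (Fin 3 → ℚ) → Prop := fun v =>
  (v 0 < v 1 ∧ v 1 < v 2) ∨ (v 2 < v 1 ∧ v 1 < v 0)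

/-- The cyclic order relation `c` on `ℚ`. -/
def cRel : (Fin 3 → ℚ) → Prop := fun v =>
  (v 0 < v 1 ∧ v 1 < v 2) ∨ (v 1 < v 2 ∧ v 2 < v 0) ∨ (v 2 < v 0 ∧ v 0 < v 1)

/-- The separation relation `s` on `ℚ`. -/
def sRel : (Fin 4 → ℚ) → Prop := fun v =>
  (cRel ![v 0, v 1, v 2] ∧ cRel ![v 2, v 3, v 0]) ∨
  (cRel ![v 2, v 1, v 0] ∧ cRel ![v 0, v 3, v 2])

/-- Relations definable from `Q` are invariant under the permutations preserving `Q`. -/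
theorem DefinableBy.invariant {M : Type*} {n k : ℕ} {Q : (Fin n → M) → Prop}
    {R : (Fin k → M) → Prop} (h : DefinableBy Q R) (g : M ≃ M)
    (hg : ∀ v, Q (g ∘ v) ↔ Q v) (v : Fin k → M) : R (g ∘ v) ↔ R v := by
  let : (relLang n).Structure M := multiRelStructure (fun _ : Unit => Q)
  obtain ⟨φ, hφ⟩ := h
  let e : M ≃[relLang n] M :=
    { g with
      map_fun' := fun f _ => f.elim
      map_rel' := fun r x => hg fun j => x (Fin.cast r.2 j) }
  rw [hφ, hφ]
  exact StrongHomClass.realize_formula e φ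

/-- Betweenness is invariant under reversing the order. -/
theorem bRel_neg (v : Fin 3 → ℚ) : bRel (Equiv.neg ℚ ∘ v) ↔ bRel v := by
  simp only [bRel, Function.comp_apply, Equiv.neg_apply, neg_lt_neg_iff]
  tauto

/-- The order relation `<` on `ℚ` is not definable from the betweenness relation `b`. -/
theorem lt_not_definable_from_betweenness : ¬ DefinableBy bRel ltRel := by
  intro h
  have := h.invariant (Equiv.neg ℚ) bRel_neg ![0, 1]
  norm_num [ltRel] at this
end

section
/- The order relation < on ℚ is definable from the pair of relations {b, c}, i.e. {b,c} ≽ <: the relation < is definable without parameters by a first-order formula in the language with two ternary relation symbols interpreted as the betweenness relation b and the cyclic order relation c on ℚ. -/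
open FirstOrder Language

/-- `R` is definable, without parameters, by a first-order formula in the language with two
relation symbols interpreted as `Q₀` and `Q₁`. -/
def DefinableBy₂ {M : Type*} {n₀ n₁ k : ℕ} (Q₀ : (Fin n₀ → M) → Prop)
    (Q₁ : (Fin n₁ → M) → Prop) (R : (Fin k → M) → Prop) : Prop :=
  letI : (multiRelLang (Bool.rec n₀ n₁ : Bool → ℕ)).Structure M :=
    multiRelStructure
      (fun i => Bool.rec (motive := fun i => (Fin (Bool.rec n₀ n₁ i) → M) → Prop) Q₀ Q₁ i)
  ∃ φ : (multiRelLang (Bool.rec n₀ n₁ : Bool → ℕ)).Formula (Fin k),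
    ∀ v : Fin k → M, R v ↔ φ.Realize v

theorem lt_iff_exists_bRel_and_cRel (x y : ℚ) :
    x < y ↔ ∃ z, bRel ![x, y, z] ∧ cRel ![x, y, z] := by
  simp only [bRel, cRel, Matrix.cons_val]
  constructor
  · intro h
    obtain ⟨z, hz⟩ := exists_gt y
    exact ⟨z, Or.inl ⟨h, hz⟩, Or.inl ⟨h, hz⟩⟩
  · rintro ⟨z, hb, hc⟩
    grind

/-- The order relation `<` on `ℚ` is definable from the pair `{b, c}` of the betweenness
and cyclic order relations. -/
theorem lt_definable_from_betweenness_and_cyclic : DefinableBy₂ bRel cRel ltRel := by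
  let L := multiRelLang (Bool.rec 3 3 : Bool → ℕ)
  let : L.Structure ℚ := multiRelStructure
    (fun i => Bool.rec (motive := fun i => (Fin (Bool.rec 3 3 i) → ℚ) → Prop) bRel cRel i)
  let B : L.Relations 3 := ⟨false, rfl⟩
  let C : L.Relations 3 := ⟨true, rfl⟩
  let ts : Fin 3 → L.Term (Fin 2 ⊕ Fin 1) :=
    ![Term.var (Sum.inl 0), Term.var (Sum.inl 1), Term.var (Sum.inr 0)]
  refine ⟨((B.boundedFormula ts ⊓ C.boundedFormula ts).ex : L.BoundedFormula (Fin 2) 0),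
    fun v => ?_⟩
  refine (lt_iff_exists_bRel_and_cRel (v 0) (v 1)).trans ?_
  refine Iff.trans (exists_congr fun z => ?_) BoundedFormula.realize_ex.symm
  have hts : (fun j => (ts j).realize (Sum.elim v (Fin.snoc default z : Fin 1 → ℚ))) =
      ![v 0, v 1, z] := by
    funext j
    fin_cases j <;> rfl
  rw [BoundedFormula.realize_inf, BoundedFormula.realize_rel, BoundedFormula.realize_rel]
  exact and_congr (congrArg bRel hts).symm.to_iff (congrArg cRel hts).symm.to_iff
end
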